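/- arXiv:math/0405272 — 4 statements merged into one kernel-verified Lean document; each statement's English description precedes it below -/
import Mathlib

section
/- Let T be a homogeneous coarsely oriented tree such that every vertex has at least two neighbors of strictly greater height and at least two neighbors of strictly smaller height. Then there exists a coarsely orientation preserving quasi-isometry from T to the oriented tree of type (2,2). -/
/-- A map `f` between two sets equipped with distance-like functions is a
quasi-isometry: it quasi-preserves distances and has coarsely dense image. -/
def IsQuasiIsometry {X Y : Type*} (d₁ : X → X → ℝ) (d₂ : Y → Y → ℝ) (f : X → Y) : Prop :=
  ∃ K C : ℝ, 1 ≤ K ∧ 0 ≤ C ∧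
    (∀ x x' : X, d₁ x x' / K - C ≤ d₂ (f x) (f x') ∧ d₂ (f x) (f x') ≤ K * d₁ x x' + C) ∧
    (∀ y : Y, ∃ x : X, d₂ y (f x) ≤ C)

/-- A coarsely orientation preserving quasi-isometry between coarsely oriented trees:
a quasi-isometry for the graph metrics which moreover coarsely preserves height
changes. -/
def IsCOPQuasiIsometry {V₁ V₂ : Type*} (G₁ : SimpleGraph V₁) (h₁ : V₁ → ℝ)
    (G₂ : SimpleGraph V₂) (h₂ : V₂ → ℝ) (f : V₁ → V₂) : Prop :=
  IsQuasiIsometry (fun u v => (G₁.dist u v : ℝ)) (fun u v => (G₂.dist u v : ℝ)) f ∧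
    ∃ C' : ℝ, 0 ≤ C' ∧ ∀ u v : V₁, |(h₂ (f v) - h₂ (f u)) - (h₁ v - h₁ u)| ≤ C'

/-- A coarsely oriented tree is homogeneous if the multiset of height changes along the
edges incident to a vertex is the same for all vertices; equivalently there is a
bijection between the neighbor sets of any two vertices matching height changes. -/
def Homogeneous {V : Type*} (G : SimpleGraph V) (h : V → ℝ) : Prop :=
  ∀ v w : V, ∃ σ : G.neighborSet v ≃ G.neighborSet w,
    ∀ u : G.neighborSet v, h u - h v = h (σ u) - h w

/-- The oriented tree of type `(2,2)`: the Cayley graph of the free group on two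
generators. -/
def T22 : SimpleGraph (FreeGroup Bool) :=
  SimpleGraph.fromRel (fun g g' => ∃ i : Bool, g' = g * FreeGroup.of i)

/-- The height function on the oriented tree of type `(2,2)`: the exponent sum. -/
noncomputable def h22 : FreeGroup Bool → ℝ :=
  fun g => ((Multiplicative.toAdd ((FreeGroup.lift fun _ => Multiplicative.ofAdd (1 : ℤ)) g) : ℤ) : ℝ)

/-- A coarse equivalence between graphs with height functions: a pair of coarsely Lipschitz maps,
coarsely inverse to each other, which coarsely preserve heights. -/
def CoarseEquiv {V₁ V₂ : Type*} (G₁ : SimpleGraph V₁) (h₁ : V₁ → ℝ)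
    (G₂ : SimpleGraph V₂) (h₂ : V₂ → ℝ) : Prop :=
  ∃ (f : V₁ → V₂) (g : V₂ → V₁) (L : ℕ) (C : ℝ),
    (∀ u v, G₁.Adj u v → G₂.dist (f u) (f v) ≤ L) ∧
    (∀ u v, G₂.Adj u v → G₁.dist (g u) (g v) ≤ L) ∧
    (∀ v, G₁.dist (g (f v)) v ≤ L) ∧ (∀ w, G₂.dist (f (g w)) w ≤ L) ∧
    (∀ v, |h₂ (f v) - h₁ v| ≤ C) ∧ (∀ w, |h₁ (g w) - h₂ w| ≤ C)

lemma dist_map_le_mul_dist {V₁ V₂ : Type*} {G₁ : SimpleGraph V₁} {G₂ : SimpleGraph V₂}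
    (c₁ : G₁.Connected) (c₂ : G₂.Connected) {f : V₁ → V₂} {L : ℕ}
    (hf : ∀ u v, G₁.Adj u v → G₂.dist (f u) (f v) ≤ L) (u v : V₁) :
    G₂.dist (f u) (f v) ≤ L * G₁.dist u v := by
  obtain ⟨p, hp⟩ := c₁.exists_walk_length_eq_dist u v
  rw [← hp]
  clear hp
  induction p with
  | nil => simp
  | @cons a b c hab q ih =>
    have h1 := c₂.dist_triangle (u := f a) (v := f b) (w := f c)
    have h2 := hf a b hab
    rw [SimpleGraph.Walk.length_cons]
    linarith

lemma dist_int_path_le {V : Type*} {G : SimpleGraph V} (c : G.Connected) {p : ℤ → V} {L : ℕ}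
    (hp : ∀ j, G.dist (p j) (p (j + 1)) ≤ L) (i j : ℤ) :
    G.dist (p i) (p j) ≤ L * (i - j).natAbs := by
  have key : ∀ (n : ℕ) (i : ℤ), G.dist (p i) (p (i + n)) ≤ L * n := by
    intro n
    induction n with
    | zero => simp
    | succ n ih =>
      intro i
      have h1 := c.dist_triangle (u := p i) (v := p (i + n)) (w := p (i + (n + 1 : ℕ)))
      have h2 := hp (i + n)
      have h3 := ih i
      push_cast at h1 ⊢
      rw [← add_assoc] at h1 ⊢
      linarith
  rcases le_total i j with hij | hij
  · have := key (i - j).natAbs i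
    rwa [show i + ((i - j).natAbs : ℤ) = j by omega] at this
  · have := key (i - j).natAbs j
    rw [SimpleGraph.dist_comm]
    rwa [show j + ((i - j).natAbs : ℤ) = i by omega] at this

lemma CoarseEquiv.exists_isCOPQuasiIsometry {V₁ V₂ M : Type*} {G₁ : SimpleGraph V₁} {h₁ : V₁ → ℝ}
    {G₂ : SimpleGraph V₂} {h₂ : V₂ → ℝ} {G : SimpleGraph M} {h : M → ℝ}
    (c₁ : G₁.Connected) (c₂ : G₂.Connected) (c : G.Connected)
    (e₁ : CoarseEquiv G₁ h₁ G h) (e₂ : CoarseEquiv G₂ h₂ G h) :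
    ∃ f : V₁ → V₂, IsCOPQuasiIsometry G₁ h₁ G₂ h₂ f := by
  obtain ⟨f₁, g₁, L₁, C₁, hf₁, hg₁, hgf₁, hfg₁, hh₁, hh₁'⟩ := e₁
  obtain ⟨f₂, g₂, L₂, C₂, hf₂, hg₂, hgf₂, hfg₂, hh₂, hh₂'⟩ := e₂
  have F₁ := dist_map_le_mul_dist c₁ c hf₁
  have K₁ := dist_map_le_mul_dist c c₁ hg₁
  have F₂ := dist_map_le_mul_dist c₂ c hf₂
  have K₂ := dist_map_le_mul_dist c c₂ hg₂
  have upper : ∀ u v, G₂.dist (g₂ (f₁ u)) (g₂ (f₁ v)) ≤ L₂ * L₁ * G₁.dist u v := fun u v =>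
    (K₂ _ _).trans (by rw [mul_assoc]; exact Nat.mul_le_mul_left _ (F₁ u v))
  have lower : ∀ u v, G₁.dist (g₁ (f₂ u)) (g₁ (f₂ v)) ≤ L₁ * L₂ * G₂.dist u v := fun u v =>
    (K₁ _ _).trans (by rw [mul_assoc]; exact Nat.mul_le_mul_left _ (F₂ u v))
  have near : ∀ v, G₁.dist (g₁ (f₂ (g₂ (f₁ v)))) v ≤ L₁ * L₂ + L₁ := fun v =>
    (c₁.dist_triangle (v := g₁ (f₁ v))).trans
      (add_le_add ((K₁ _ _).trans (Nat.mul_le_mul_left _ (hfg₂ _))) (hgf₁ v))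
  have near' : ∀ v, G₂.dist (g₂ (f₁ (g₁ (f₂ v)))) v ≤ L₂ * L₁ + L₂ := fun v =>
    (c₂.dist_triangle (v := g₂ (f₂ v))).trans
      (add_le_add ((K₂ _ _).trans (Nat.mul_le_mul_left _ (hfg₁ _))) (hgf₂ v))
  have hL₁ : (0 : ℝ) ≤ L₁ := Nat.cast_nonneg _
  have hL₂ : (0 : ℝ) ≤ L₂ := Nat.cast_nonneg _
  refine ⟨fun v => g₂ (f₁ v), ⟨L₁ * L₂ + 1, 2 * (L₁ * L₂ + L₁) + L₂, ?_, by positivity, ?_, ?_⟩, ?_⟩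
  · nlinarith
  · intro u v
    have hu : (G₂.dist (g₂ (f₁ u)) (g₂ (f₁ v)) : ℝ) ≤ L₂ * L₁ * G₁.dist u v := by
      exact_mod_cast upper u v
    have hd : (0 : ℝ) ≤ G₁.dist u v := Nat.cast_nonneg _
    have hd' : (0 : ℝ) ≤ G₂.dist (g₂ (f₁ u)) (g₂ (f₁ v)) := Nat.cast_nonneg _
    constructor
    · have hlow : (G₁.dist u v : ℝ) ≤
          L₁ * L₂ * G₂.dist (g₂ (f₁ u)) (g₂ (f₁ v)) + 2 * (L₁ * L₂ + L₁) := by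
        have t1 := c₁.dist_triangle (u := u) (v := g₁ (f₂ (g₂ (f₁ u)))) (w := v)
        have t2 := c₁.dist_triangle (u := g₁ (f₂ (g₂ (f₁ u)))) (v := g₁ (f₂ (g₂ (f₁ v)))) (w := v)
        have t3 := near u
        rw [SimpleGraph.dist_comm] at t3
        have t4 := near v
        have t5 := lower (g₂ (f₁ u)) (g₂ (f₁ v))
        have : G₁.dist u v ≤
          L₁ * L₂ * G₂.dist (g₂ (f₁ u)) (g₂ (f₁ v)) + 2 * (L₁ * L₂ + L₁) := by linarith
        exact_mod_cast this
      rw [sub_le_iff_le_add, div_le_iff₀ (by positivity)]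
      have hp : 0 ≤ (L₁ : ℝ) * L₂ := by positivity
      set P : ℝ := L₁ * L₂
      nlinarith [mul_nonneg hp hp, mul_nonneg hp hL₁, mul_nonneg hp hL₂]
    · nlinarith [mul_nonneg hL₁ hL₂]
  · intro w
    refine ⟨g₁ (f₂ w), ?_⟩
    have := near' w
    rw [SimpleGraph.dist_comm] at this
    have h' : (G₂.dist w (g₂ (f₁ (g₁ (f₂ w)))) : ℝ) ≤ L₂ * L₁ + L₂ := by exact_mod_cast this
    nlinarith [mul_nonneg hL₁ hL₂]
  · have hd : ∀ v, |h₂ (g₂ (f₁ v)) - h₁ v| ≤ C₁ + C₂ := fun v => by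
      have := abs_add_le (h₂ (g₂ (f₁ v)) - h (f₁ v)) (h (f₁ v) - h₁ v)
      rw [sub_add_sub_cancel] at this
      linarith [hh₁ v, hh₂' (f₁ v)]
    obtain ⟨v₀⟩ := c₁.nonempty
    refine ⟨2 * (C₁ + C₂), by linarith [hd v₀, abs_nonneg (h₂ (g₂ (f₁ v₀)) - h₁ v₀)], fun u v => ?_⟩
    have := abs_sub (h₂ (g₂ (f₁ v)) - h₁ v) (h₂ (g₂ (f₁ u)) - h₁ u)
    have hu := abs_le.1 (hd u)
    have hv := abs_le.1 (hd v)
    rw [abs_le]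
    constructor <;> linarith

/-- The model graph: a line of integers for every word of integers, the line of the word `m :: w`
being attached to the line of `w` by an edge joining the points of coordinate `m`. -/
def lineModel : SimpleGraph (List ℤ × ℤ) :=
  SimpleGraph.fromRel fun a b => b = (a.1, a.2 + 1) ∨ b = (a.2 :: a.1, a.2)

lemma lineModel_adj_succ (w : List ℤ) (m : ℤ) : lineModel.Adj (w, m) (w, m + 1) := by
  simp [lineModel]

lemma lineModel_adj_cons (w : List ℤ) (m : ℤ) : lineModel.Adj (w, m) (m :: w, m) := by
  simp [lineModel]

lemma lineModel_connected : lineModel.Connected := by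
  have hline : ∀ (w : List ℤ) (m : ℤ), lineModel.Reachable (w, 0) (w, m) := by
    intro w m
    induction m using Int.induction_on with
    | zero => exact .refl _
    | succ i ih => exact ih.trans (lineModel_adj_succ _ _).reachable
    | pred i ih =>
      refine ih.trans (SimpleGraph.Adj.reachable ?_)
      have := lineModel_adj_succ w (-i - 1)
      rw [sub_add_cancel] at this
      exact this.symm
  have hroot : ∀ (w : List ℤ), lineModel.Reachable ([], 0) (w, 0) := by
    intro w
    induction w with
    | nil => exact .refl _
    | cons m w ih =>
      exact (ih.trans (hline w m)).trans ((lineModel_adj_cons w m).reachable.trans (hline _ m).symm)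
  have : ∀ a, lineModel.Reachable ([], 0) a := fun a => (hroot a.1).trans (hline a.1 a.2)
  exact ⟨fun a b => (this a).symm.trans (this b)⟩

lemma lineModel_dist_le (w : List ℤ) (i j : ℤ) :
    lineModel.dist (w, i) (w, j) ≤ (i - j).natAbs := by
  have := dist_int_path_le lineModel_connected (p := fun j => (w, j)) (L := 1)
    (fun j => (SimpleGraph.dist_eq_one_iff_adj.2 (lineModel_adj_succ w j)).le) i j
  simpa using this

lemma exists_equiv_int_of_fiber_embeddings {S : Type*} (α : S → ℤ) {k : ℕ} (hk : 0 < k) (b : ℤ)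
    (hle : ∀ j, Nonempty ({s // α s = j} ↪ Fin k))
    (hge : ∀ j, j ≠ b → Nonempty (Fin k ↪ {s // α s = j})) :
    ∃ e : S ≃ ℤ, ∀ s, |e s - k * α s| ≤ 2 * k := by
  have hk' : (0 : ℤ) < k := by exact_mod_cast hk
  have E := fun j => (hle j).some
  have hge' : ∀ n : ℤ, Nonempty (Fin k ↪ {s // α s = if n < b then n else n + 1}) := fun n =>
    hge _ (by split_ifs <;> omega)
  have E' := fun n => (hge' n).some
  have hlt : ∀ m : ℤ, (m % k).toNat < k := fun m => by
    have := Int.emod_lt_of_pos m hk'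
    have := Int.emod_nonneg m hk'.ne'
    omega
  let f : S → ℤ := fun s => k * α s + (E (α s) ⟨s, rfl⟩ : ℕ)
  let g : ℤ → S := fun m => (E' (m / k) ⟨(m % k).toNat, hlt m⟩).1
  have hfdiv : ∀ s, f s / k = α s := fun s => by
    have h1 := (E (α s) ⟨s, rfl⟩).2
    simp only [f]
    rw [Int.mul_add_ediv_left _ _ hk'.ne', Int.ediv_eq_zero_of_lt (by positivity)
      (by exact_mod_cast h1), add_zero]
  have hf : Function.Injective f := by
    intro s t hst
    have hα : α s = α t := by rw [← hfdiv s, ← hfdiv t, hst]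
    have hcongr : ∀ (j : ℤ) (hs : α s = j) (ht : α t = j),
        (E j ⟨s, hs⟩ : ℕ) = E j ⟨t, ht⟩ → s = t := fun j hs ht h =>
      congrArg Subtype.val ((E j).injective (Fin.ext h))
    have hE : ∀ (j : ℤ) (hs : α s = j), (E (α s) ⟨s, rfl⟩ : ℕ) = E j ⟨s, hs⟩ := by
      rintro _ rfl; rfl
    refine hcongr (α t) hα rfl ?_
    rw [← hE _ hα]
    have : (k * α s + (E (α s) ⟨s, rfl⟩ : ℕ) : ℤ) = k * α t + (E (α t) ⟨t, rfl⟩ : ℕ) := hst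
    have hkα : (k * α s : ℤ) = k * α t := by rw [hα]
    zify
    linarith
  have hαg : ∀ m, α (g m) = if m / k < b then m / k else m / k + 1 := fun m =>
    (E' (m / k) ⟨(m % k).toNat, hlt m⟩).2
  have hg : Function.Injective g := by
    intro m m' hmm
    have h1 : m / k = m' / k := by
      have := congrArg α hmm
      rw [hαg, hαg] at this
      split_ifs at this <;> omega
    have hcongr : ∀ (n n' : ℤ) (i i' : Fin k), n = n' → (E' n i).1 = (E' n' i').1 → i = i' := by
      rintro n _ i i' rfl h
      exact (E' n).injective (Subtype.ext h)
    have h2 := congrArg Fin.val (hcongr _ _ _ _ h1 hmm)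
    have h3 := Int.emod_nonneg m hk'.ne'
    have h4 := Int.emod_nonneg m' hk'.ne'
    have h5 : m % k = m' % k := by
      simp only at h2
      omega
    rw [← Int.mul_ediv_add_emod m k, ← Int.mul_ediv_add_emod m' k, h1, h5]
  obtain ⟨e, he, hR⟩ := Function.Embedding.schroeder_bernstein_of_rel hf hg
    (fun s m => |m - k * α s| ≤ 2 * k)
    (fun s => by
      have h1 := (E (α s) ⟨s, rfl⟩).2
      simp only [f, add_sub_cancel_left, Nat.abs_cast]
      norm_cast
      omega)
    (fun m => by
      have h1 := Int.mul_ediv_add_emod m k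
      have h2 := Int.emod_nonneg m hk'.ne'
      have h3 := Int.emod_lt_of_pos m hk'
      rw [hαg, abs_le]
      split_ifs
      · constructor <;> linarith
      · rw [mul_add]
        constructor <;> linarith)
  exact ⟨Equiv.ofBijective e he, hR⟩

/-- The graph `G` is a tree rooted at `o`, with parent map `par` and depth function `dp`. -/
structure IsRootedTree {V : Type*} (G : SimpleGraph V) (o : V) (par : V → V) (dp : V → ℕ) :
    Prop where
  connected : G.Connected
  depth_root : dp o = 0
  adj_par : ∀ v, v ≠ o → G.Adj (par v) v
  depth_par : ∀ v, v ≠ o → dp v = dp (par v) + 1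
  eq_par_of_adj : ∀ u v, G.Adj u v → (v ≠ o ∧ par v = u) ∨ (u ≠ o ∧ par u = v)

/-- A choice, for every vertex `y` of a rooted tree, of a bi-infinite path `x y` whose topmost
vertex is `y`, reached at the time `b y`. -/
structure LineFamily {V : Type*} (o : V) (par : V → V) (dp : V → ℕ) (x : V → ℤ → V)
    (b : V → ℤ) : Prop where
  base : ∀ y, x y (b y) = y
  succ_ne : ∀ y j, b y ≤ j → x y (j + 1) ≠ o
  par_succ : ∀ y j, b y ≤ j → par (x y (j + 1)) = x y j
  pred_ne : ∀ y j, j ≤ b y → x y (j - 1) ≠ o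
  par_pred : ∀ y j, j ≤ b y → par (x y (j - 1)) = x y j
  inj : ∀ y, Function.Injective (x y)
  depth : ∀ y j, dp (x y j) = dp y + (j - b y).natAbs

/-- The vertices hanging from the path `x y`: those which are not on the path while their parent
is. -/
def hanging {V : Type*} (o : V) (par : V → V) (x : V → ℤ → V) (y : V) : Set V :=
  {z | z ≠ o ∧ (∃ j, x y j = par z) ∧ ∀ j, x y j ≠ z}

section LineFamily

variable {V : Type*} {G : SimpleGraph V} {o : V} {par : V → V} {dp : V → ℕ} {x : V → ℤ → V}
  {b : V → ℤ}

/-- The set of children of a vertex. -/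
def children (o : V) (par : V → V) (v : V) : Set V := {z | z ≠ o ∧ par z = v}

lemma IsRootedTree.neighborSet_eq (T : IsRootedTree G o par dp) (v : V) :
    G.neighborSet v = children o par v ∪ {u | v ≠ o ∧ u = par v} := by
  ext z
  simp only [SimpleGraph.mem_neighborSet, children, Set.mem_union, Set.mem_ofPred_eq]
  constructor
  · intro hz
    rcases T.eq_par_of_adj _ _ hz with ⟨h1, h2⟩ | ⟨h1, h2⟩
    · exact Or.inl ⟨h1, h2⟩
    · exact Or.inr ⟨h1, h2.symm⟩
  · rintro (⟨h1, rfl⟩ | ⟨h1, rfl⟩)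
    · exact T.adj_par z h1
    · exact (T.adj_par v h1).symm

lemma IsRootedTree.finite_children (T : IsRootedTree G o par dp) {v : V}
    (hfin : (G.neighborSet v).Finite) : (children o par v).Finite :=
  hfin.subset (by rw [T.neighborSet_eq v]; exact Set.subset_union_left)

lemma IsRootedTree.ncard_children (T : IsRootedTree G o par dp) {v : V}
    (hfin : (G.neighborSet v).Finite) (hv : v ≠ o) :
    (children o par v).ncard + 1 = (G.neighborSet v).ncard := by
  have hnot : par v ∉ children o par v := by
    rintro ⟨h1, h2⟩
    have h3 := T.depth_par _ h1
    have h4 := T.depth_par _ hv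
    rw [h2] at h3
    omega
  rw [T.neighborSet_eq v, ← Set.ncard_insert_of_notMem hnot (T.finite_children hfin)]
  congr 1
  ext z
  simp [hv]

lemma LineFamily.hanging_fiber_of_ne_base (T : IsRootedTree G o par dp)
    (lf : LineFamily o par dp x b) (y : V) {j : ℤ} (hj : j ≠ b y) :
    ∃ c ∈ children o par (x y j),
      {z | z ∈ hanging o par x y ∧ par z = x y j} = children o par (x y j) \ {c} := by
  rcases lt_or_gt_of_ne hj with hlt | hgt
  · refine ⟨x y (j - 1), ⟨lf.pred_ne y j hlt.le, lf.par_pred y j hlt.le⟩, ?_⟩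
    ext z
    simp only [hanging, children, Set.mem_ofPred_eq, Set.mem_sdiff, Set.mem_singleton_iff]
    constructor
    · rintro ⟨⟨h1, -, h3⟩, h4⟩
      exact ⟨⟨h1, h4⟩, fun h => h3 _ h.symm⟩
    · rintro ⟨⟨h1, h2⟩, h3⟩
      refine ⟨⟨h1, ⟨j, h2.symm⟩, ?_⟩, h2⟩
      rintro i rfl
      have hd := T.depth_par _ h1
      rw [h2, lf.depth, lf.depth] at hd
      rcases le_or_gt (b y) (i - 1) with hi | hi
      · have := lf.par_succ y (i - 1) hi
        rw [sub_add_cancel, h2] at this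
        have := lf.inj y this
        omega
      · have : i = j - 1 := by omega
        exact h3 (by rw [this])
  · refine ⟨x y (j + 1), ⟨lf.succ_ne y j hgt.le, lf.par_succ y j hgt.le⟩, ?_⟩
    ext z
    simp only [hanging, children, Set.mem_ofPred_eq, Set.mem_sdiff, Set.mem_singleton_iff]
    constructor
    · rintro ⟨⟨h1, -, h3⟩, h4⟩
      exact ⟨⟨h1, h4⟩, fun h => h3 _ h.symm⟩
    · rintro ⟨⟨h1, h2⟩, h3⟩
      refine ⟨⟨h1, ⟨j, h2.symm⟩, ?_⟩, h2⟩
      rintro i rfl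
      have hd := T.depth_par _ h1
      rw [h2, lf.depth, lf.depth] at hd
      rcases le_or_gt (i + 1) (b y) with hi | hi
      · have := lf.par_pred y (i + 1) hi
        rw [add_sub_cancel_right, h2] at this
        have := lf.inj y this
        omega
      · have : i = j + 1 := by omega
        exact h3 (by rw [this])

lemma LineFamily.ne_root (T : IsRootedTree G o par dp) (lf : LineFamily o par dp x b) {y : V} {j : ℤ}
    (hj : j ≠ b y) : x y j ≠ o := by
  intro h
  have h1 := lf.depth y j
  rw [h, T.depth_root] at h1
  omega

lemma LineFamily.exists_hanging_equiv (T : IsRootedTree G o par dp) (lf : LineFamily o par dp x b)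
    {k : ℕ} (hk : 0 < k) (hfin : ∀ v, (G.neighborSet v).Finite)
    (hcard : ∀ v, (G.neighborSet v).ncard = k + 2) (y : V) :
    ∃ e : hanging o par x y ≃ ℤ, ∀ z j, x y j = par z.1 → |e z - k * j| ≤ 2 * k := by
  choose α hα using fun z : hanging o par x y => z.2.2.1
  have himage : ∀ j, Set.image Subtype.val {z | α z = j} =
      {z | z ∈ hanging o par x y ∧ par z = x y j} := by
    intro j
    ext z
    constructor
    · rintro ⟨z, hz, rfl⟩
      exact ⟨z.2, by rw [← hα z, hz]⟩
    · rintro ⟨hz, hzj⟩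
      exact ⟨⟨z, hz⟩, lf.inj y ((hα _).trans hzj), rfl⟩
  have hffin : ∀ j, {z | z ∈ hanging o par x y ∧ par z = x y j}.Finite := fun j =>
    (T.finite_children (hfin (x y j))).subset fun z hz => ⟨hz.1.1, hz.2⟩
  have hncard : ∀ j, {z | α z = j}.ncard =
      {z | z ∈ hanging o par x y ∧ par z = x y j}.ncard := fun j => by
    rw [← himage, Set.ncard_image_of_injective _ Subtype.val_injective]
  have hfinα : ∀ j, {z | α z = j}.Finite := fun j =>
    Set.Finite.of_finite_image (by rw [himage]; exact hffin j) Subtype.val_injective.injOn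
  have hne : ∀ j, j ≠ b y → {z | α z = j}.ncard = k := by
    intro j hj
    obtain ⟨c, hc, hfib⟩ := lf.hanging_fiber_of_ne_base T y hj
    have h1 := T.ncard_children (hfin _) (lf.ne_root T hj)
    have h2 := Set.ncard_sdiff_singleton_add_one hc (T.finite_children (hfin _))
    rw [hncard, hfib]
    have := hcard (x y j)
    omega
  have hbase : {z | α z = b y}.ncard ≤ k := by
    have hc1 : x y (b y + 1) ∈ children o par y :=
      ⟨lf.succ_ne y _ le_rfl, by rw [lf.par_succ y _ le_rfl, lf.base]⟩
    have hc2 : x y (b y - 1) ∈ children o par y :=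
      ⟨lf.pred_ne y _ le_rfl, by rw [lf.par_pred y _ le_rfl, lf.base]⟩
    have hc12 : x y (b y - 1) ≠ x y (b y + 1) := fun h => by
      have := lf.inj y h
      omega
    have hfinc := T.finite_children (hfin y)
    have h1 := Set.ncard_sdiff_singleton_add_one hc1 hfinc
    have h2 := Set.ncard_sdiff_singleton_add_one (a := x y (b y - 1))
      (s := children o par y \ {x y (b y + 1)}) ⟨hc2, hc12⟩ hfinc.sdiff
    have h3 : (children o par y).ncard ≤ (G.neighborSet y).ncard :=
      Set.ncard_le_ncard (by rw [T.neighborSet_eq y]; exact Set.subset_union_left) (hfin y)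
    have h4 : {z | z ∈ hanging o par x y ∧ par z = x y (b y)}.ncard ≤
        ((children o par y \ {x y (b y + 1)}) \ {x y (b y - 1)}).ncard := by
      refine Set.ncard_le_ncard ?_ hfinc.sdiff.sdiff
      rintro z ⟨⟨hz1, -, hz2⟩, hz3⟩
      exact ⟨⟨⟨hz1, by rw [hz3, lf.base]⟩, fun h => hz2 _ h.symm⟩, fun h => hz2 _ h.symm⟩
    have := hcard y
    rw [hncard]
    omega
  have hle : ∀ j, {z | α z = j}.ncard ≤ k := fun j => by
    by_cases hj : j = b y
    · rw [hj]; exact hbase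
    · exact (hne j hj).le
  obtain ⟨e, he⟩ := exists_equiv_int_of_fiber_embeddings α hk (b y)
    (fun j => by
      have : Fintype {z // α z = j} := (hfinα j).fintype
      refine Function.Embedding.nonempty_of_card_le ?_
      rw [Fintype.card_fin, ← Nat.card_eq_fintype_card]
      exact hle j)
    (fun j hj => by
      have : Fintype {z // α z = j} := (hfinα j).fintype
      refine Function.Embedding.nonempty_of_card_le ?_
      rw [Fintype.card_fin, ← Nat.card_eq_fintype_card]
      exact (hne j hj).ge)
  refine ⟨e, fun z j hj => ?_⟩
  have : j = α z := lf.inj y (hj.trans (hα z).symm)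
  rw [this]
  exact he z

lemma LineFamily.dist_le (T : IsRootedTree G o par dp) (lf : LineFamily o par dp x b) (y : V)
    (i j : ℤ) : G.dist (x y i) (x y j) ≤ (i - j).natAbs := by
  have := dist_int_path_le T.connected (p := x y) (L := 1) (fun j => by
    refine (SimpleGraph.dist_eq_one_iff_adj.2 ?_).le
    rcases le_or_gt (b y) j with hj | hj
    · have := T.adj_par _ (lf.succ_ne y j hj)
      rwa [lf.par_succ y j hj] at this
    · have := T.adj_par _ (lf.pred_ne y (j + 1) hj)
      rw [lf.par_pred y (j + 1) hj, add_sub_cancel_right] at this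
      exact this.symm) i j
  simpa using this

/-- The topmost vertex of the line indexed by a word, given indexings of the hanging vertices. -/
def lineTop (o : V) (par : V → V) (x : V → ℤ → V) (e : ∀ y, hanging o par x y ≃ ℤ) : List ℤ → V
  | [] => o
  | m :: w => ((e (lineTop o par x e w)).symm m).1

lemma lineTop_cons_mem (e : ∀ y, hanging o par x y ≃ ℤ) (m : ℤ) (w : List ℤ) :
    lineTop o par x e (m :: w) ∈ hanging o par x (lineTop o par x e w) :=
  ((e (lineTop o par x e w)).symm m).2

lemma LineFamily.par_cases (lf : LineFamily o par dp x b) (y : V) (j : ℤ) :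
    j = b y ∨ (j ≠ b y ∧ ∃ i, |i - j| = 1 ∧ par (x y j) = x y i) := by
  rcases lt_trichotomy j (b y) with hj | hj | hj
  · refine Or.inr ⟨hj.ne, j + 1, by simp, ?_⟩
    have := lf.par_pred y (j + 1) hj
    rwa [add_sub_cancel_right] at this
  · exact Or.inl hj
  · refine Or.inr ⟨hj.ne', j - 1, by simp, ?_⟩
    have := lf.par_succ y (j - 1) (by omega)
    rwa [sub_add_cancel] at this

lemma LineFamily.lineTop_bijective (T : IsRootedTree G o par dp) (lf : LineFamily o par dp x b)
    (e : ∀ y, hanging o par x y ≃ ℤ) :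
    Function.Bijective fun a : List ℤ × ℤ => x (lineTop o par x e a.1) a.2 := by
  set Y := lineTop o par x e with hY
  have hmem : ∀ m w, Y (m :: w) ∈ hanging o par x (Y w) := lineTop_cons_mem e
  have hroot : ∀ w j, x (Y w) j = o → w = [] := by
    intro w j hwj
    have h1 := lf.depth (Y w) j
    rw [hwj, T.depth_root] at h1
    cases w with
    | nil => rfl
    | cons m w =>
      have h2 := T.depth_par _ (hmem m w).1
      omega
  have words : ∀ n v, dp v = n → ∀ w w' j j', x (Y w) j = v → x (Y w') j' = v → w = w' := by
    intro n
    induction n with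
    | zero =>
      intro v hv w w' j j' hw hw'
      have hvo : v = o := by
        by_contra hvo
        have := T.depth_par v hvo
        omega
      rw [hroot w j (hw.trans hvo), hroot w' j' (hw'.trans hvo)]
    | succ n ih =>
      intro v hv
      have hvo : v ≠ o := by
        rintro rfl
        rw [T.depth_root] at hv
        omega
      have hpar : dp (par v) = n := by
        have := T.depth_par v hvo
        omega
      have top : ∀ w j, x (Y w) j = v → j = b (Y w) → ∃ m u, w = m :: u ∧ Y w = v := by
        intro w j hw hj
        rw [hj, lf.base] at hw
        cases w with
        | nil => exact absurd hw.symm hvo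
        | cons m u => exact ⟨m, u, rfl, hw⟩
      have mixed : ∀ w w' j j', x (Y w) j = v → x (Y w') j' = v → j = b (Y w) → j' ≠ b (Y w') →
          False := by
        intro w w' j j' hw hw' hj hj'
        obtain ⟨m, u, rfl, hv'⟩ := top w j hw hj
        obtain ⟨-, ⟨i, hi⟩, h3⟩ := hmem m u
        rcases lf.par_cases (Y w') j' with h | ⟨-, i', -, hi'⟩
        · exact hj' h
        · rw [hw'] at hi'
          rw [hv'] at hi
          obtain rfl := ih (par v) hpar u w' i i' hi hi'.symm
          exact h3 j' (hw'.trans hv'.symm)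
      intro w w' j j' hw hw'
      by_cases hj : j = b (Y w) <;> by_cases hj' : j' = b (Y w')
      · obtain ⟨m, u, rfl, hv1⟩ := top w j hw hj
        obtain ⟨m', u', rfl, hv2⟩ := top w' j' hw' hj'
        obtain ⟨-, ⟨i, hi⟩, -⟩ := hmem m u
        obtain ⟨-, ⟨i', hi'⟩, -⟩ := hmem m' u'
        rw [hv1] at hi
        rw [hv2] at hi'
        obtain rfl := ih (par v) hpar u u' i i' hi hi'
        have : (e (Y u)).symm m = (e (Y u)).symm m' := Subtype.ext (hv1.trans hv2.symm)
        rw [(e (Y u)).symm.injective this]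
      · exact (mixed w w' j j' hw hw' hj hj').elim
      · exact (mixed w' w j' j hw' hw hj' hj).elim
      · obtain h | ⟨-, i, -, hi⟩ := lf.par_cases (Y w) j
        · exact absurd h hj
        obtain h | ⟨-, i', -, hi'⟩ := lf.par_cases (Y w') j'
        · exact absurd h hj'
        rw [hw] at hi
        rw [hw'] at hi'
        exact ih (par v) hpar w w' i i' hi.symm hi'.symm
  refine ⟨?_, ?_⟩
  · rintro ⟨w, j⟩ ⟨w', j'⟩ h
    obtain rfl := words _ _ rfl w w' j j' h rfl
    exact Prod.ext rfl (lf.inj _ h)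
  · have surj : ∀ n v, dp v = n → ∃ w j, x (Y w) j = v := by
      intro n
      induction n with
      | zero =>
        intro v hv
        have hvo : v = o := by
          by_contra hvo
          have := T.depth_par v hvo
          omega
        exact ⟨[], b o, by rw [hvo]; exact lf.base o⟩
      | succ n ih =>
        intro v hv
        have hvo : v ≠ o := by
          rintro rfl
          rw [T.depth_root] at hv
          omega
        obtain ⟨w, j, hwj⟩ := ih (par v) (by have := T.depth_par v hvo; omega)
        by_cases hv' : ∃ i, x (Y w) i = v
        · obtain ⟨i, hi⟩ := hv'
          exact ⟨w, i, hi⟩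
        · push Not at hv'
          have hvY : v ∈ hanging o par x (Y w) := ⟨hvo, ⟨j, hwj⟩, hv'⟩
          have : Y (e (Y w) ⟨v, hvY⟩ :: w) = v := by
            change ((e (Y w)).symm (e (Y w) ⟨v, hvY⟩)).1 = v
            rw [Equiv.symm_apply_apply]
          exact ⟨e (Y w) ⟨v, hvY⟩ :: w, b v, by rw [this, lf.base]⟩
    intro v
    obtain ⟨w, j, h⟩ := surj _ v rfl
    exact ⟨(w, j), h⟩

end LineFamily

lemma LineFamily.coarseEquiv_lineModel {V : Type*} {G : SimpleGraph V} {o : V} {par : V → V}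
    {dp : V → ℕ} {x : V → ℤ → V} {b : V → ℤ} (T : IsRootedTree G o par dp)
    (lf : LineFamily o par dp x b) {k : ℕ} (hk : 0 < k) (hfin : ∀ v, (G.neighborSet v).Finite)
    (hcard : ∀ v, (G.neighborSet v).ncard = k + 2) {h : V → ℝ} {H : ℝ}
    (hH : ∀ u v, G.Adj u v → |h u - h v| ≤ H) {σ C : ℝ} (hσ : 0 < σ)
    (htrack : ∀ y j, |h (x y j) - σ * j| ≤ C) :
    CoarseEquiv G h lineModel fun a => σ / k * a.2 := by
  have hk' : (0 : ℤ) < k := by exact_mod_cast hk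
  choose e he using lf.exists_hanging_equiv T hk hfin hcard
  set Y := lineTop o par x e with hY
  let φ : List ℤ × ℤ ≃ V := Equiv.ofBijective _ (lf.lineTop_bijective T e)
  have hφ : ∀ w j, φ (w, j) = x (Y w) j := fun _ _ => rfl
  set B : ℕ := ⌈(2 * C + H) / σ⌉₊ with hB
  have attach : ∀ m w, ∃ j, x (Y w) j = par (Y (m :: w)) ∧ |m - k * j| ≤ 2 * k ∧
      |b (Y (m :: w)) - j| ≤ B := by
    intro m w
    obtain ⟨hne, ⟨j, hj⟩, -⟩ := lineTop_cons_mem e m w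
    refine ⟨j, hj, ?_, ?_⟩
    · have := he (Y w) ((e (Y w)).symm m) j hj
      rwa [Equiv.apply_symm_apply] at this
    · have h1 := abs_le.1 (htrack (Y (m :: w)) (b (Y (m :: w))))
      rw [lf.base] at h1
      have h2 := abs_le.1 (htrack (Y w) j)
      have h3 := abs_le.1 (hH _ _ (T.adj_par _ hne))
      rw [← hj] at h3
      have h4 : |σ * ((b (Y (m :: w)) : ℝ) - j)| ≤ 2 * C + H := by
        rw [abs_le]
        constructor <;> linarith
      rw [abs_mul, abs_of_pos hσ, mul_comm, ← le_div_iff₀ hσ] at h4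
      have h5 := h4.trans (Nat.le_ceil _)
      exact_mod_cast h5
  have hdiv : ∀ m j : ℤ, |m - k * j| ≤ 2 * k → (m / k - j).natAbs ≤ 2 := by
    intro m j hmj
    rw [abs_le] at hmj
    have h1 : m / k ≤ j + 2 := by
      have : m / k < j + 3 := Int.ediv_lt_of_lt_mul hk' (by linarith)
      omega
    have h2 : j - 2 ≤ m / k := Int.le_ediv_of_mul_le hk' (by linarith)
    omega
  have edge : ∀ v, v ≠ o →
      lineModel.dist ((φ.symm (par v)).1, k * (φ.symm (par v)).2)
        ((φ.symm v).1, k * (φ.symm v).2) ≤ k * B + 4 * k + 1 := by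
    intro v hv
    obtain ⟨⟨w, j⟩, rfl⟩ := φ.surjective v
    rw [Equiv.symm_apply_apply]
    rcases lf.par_cases (Y w) j with hj | ⟨-, i, hi, hpar⟩
    · cases w with
      | nil =>
        rw [hφ, hj, lf.base] at hv
        exact absurd rfl hv
      | cons m w =>
        obtain ⟨i, hi, hmi, hbi⟩ := attach m w
        have hpar : φ.symm (par (φ (m :: w, j))) = (w, i) := by
          rw [Equiv.symm_apply_eq, hφ, hφ, hj, lf.base, hi]
        rw [hpar]
        have d1 := lineModel_dist_le w (k * i) m
        have d2 := (SimpleGraph.dist_eq_one_iff_adj.2 (lineModel_adj_cons w m)).le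
        have d3 := lineModel_dist_le (m :: w) m (k * j)
        have t1 := lineModel_connected.dist_triangle (u := (w, k * i)) (v := (w, m))
          (w := (m :: w, k * j))
        have t2 := lineModel_connected.dist_triangle (u := (w, m)) (v := (m :: w, m))
          (w := (m :: w, k * j))
        have n1 : (k * i - m).natAbs ≤ 2 * k := by
          rw [abs_le] at hmi
          omega
        have n2 : (m - k * j).natAbs ≤ 2 * k + k * B := by
          have h3 : |k * i - k * j| ≤ k * B := by
            rw [← mul_sub, abs_mul, abs_of_pos hk', abs_sub_comm, hj]
            exact mul_le_mul_of_nonneg_left hbi hk'.le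
          have h4 := abs_sub_le m (k * i) (k * j)
          have h5 : |m - k * j| ≤ ((2 * k + k * B : ℕ) : ℤ) := by
            push_cast
            linarith
          rw [Int.abs_eq_natAbs] at h5
          exact_mod_cast h5
        simp only
        linarith
    · have hpar' : φ.symm (par (φ (w, j))) = (w, i) := by
        rw [Equiv.symm_apply_eq, hφ, hφ, hpar]
      rw [hpar']
      refine (lineModel_dist_le w (k * i) (k * j)).trans ?_
      rw [← mul_sub, Int.natAbs_mul, Int.natAbs_natCast]
      have : (i - j).natAbs = 1 := by
        rw [Int.abs_eq_natAbs] at hi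
        exact_mod_cast hi
      rw [this, mul_one]
      nlinarith [Nat.zero_le (k * B)]
  have edge' : ∀ a a' : List ℤ × ℤ, (a' = (a.1, a.2 + 1) ∨ a' = (a.2 :: a.1, a.2)) →
      G.dist (φ (a.1, a.2 / k)) (φ (a'.1, a'.2 / k)) ≤ B + 5 := by
    rintro ⟨w, m⟩ _ (rfl | rfl)
    · refine (lf.dist_le T (Y w) _ _).trans ?_
      have h1 : m / k ≤ (m + 1) / k := Int.ediv_le_ediv hk' (by simp)
      have h2 : (m + 1) / k ≤ m / k + 1 := by
        have : (m + k * 1) / k = m / k + 1 := Int.add_mul_ediv_left _ _ hk'.ne'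
        rw [← this]
        exact Int.ediv_le_ediv hk' (by omega)
      simp only
      omega
    · obtain ⟨j, hj, hmj, hbj⟩ := attach m w
      have hz := lineTop_cons_mem e m w
      have d1 := lf.dist_le T (Y w) (m / k) j
      have d2 : G.dist (x (Y w) j) (Y (m :: w)) ≤ 1 := by
        rw [hj]
        exact (SimpleGraph.dist_eq_one_iff_adj.2 (T.adj_par _ hz.1)).le
      have d3 := lf.dist_le T (Y (m :: w)) (b (Y (m :: w))) (m / k)
      rw [lf.base] at d3
      have t1 := T.connected.dist_triangle (u := x (Y w) (m / k)) (v := x (Y w) j)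
        (w := x (Y (m :: w)) (m / k))
      have t2 := T.connected.dist_triangle (u := x (Y w) j) (v := Y (m :: w))
        (w := x (Y (m :: w)) (m / k))
      have n1 := hdiv m j hmj
      have n2 : (b (Y (m :: w)) - m / k).natAbs ≤ B + 2 := by
        rw [abs_le] at hbj
        omega
      rw [hφ, hφ]
      simp only
      omega
  have hkσ : ∀ j : ℤ, σ / k * ((k * j : ℤ) : ℝ) = σ * j := by
    intro j
    have : (k : ℝ) ≠ 0 := by exact_mod_cast hk.ne'
    push_cast
    field_simp
  have hC : 0 ≤ C := (abs_nonneg _).trans (htrack o 0)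
  refine ⟨fun v => ((φ.symm v).1, k * (φ.symm v).2), fun a => φ (a.1, a.2 / k),
    k * B + 4 * k + B + 5, C + σ, ?_, ?_, ?_, ?_, ?_, ?_⟩
  · intro u v huv
    rcases T.eq_par_of_adj u v huv with ⟨h1, rfl⟩ | ⟨h1, rfl⟩
    · exact (edge v h1).trans (by omega)
    · rw [SimpleGraph.dist_comm]
      exact (edge u h1).trans (by omega)
  · intro a a' haa'
    obtain ⟨-, h1 | h1⟩ := haa'
    · exact (edge' a a' h1).trans (by omega)
    · rw [SimpleGraph.dist_comm]
      exact (edge' a' a h1).trans (by omega)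
  · intro v
    simp only [Int.mul_ediv_cancel_left _ hk'.ne', Prod.mk.eta, Equiv.apply_symm_apply,
      SimpleGraph.dist_self]
    exact Nat.zero_le _
  · rintro ⟨w, m⟩
    simp only [Equiv.symm_apply_apply]
    refine (lineModel_dist_le w _ _).trans ?_
    have h1 := Int.mul_ediv_add_emod m k
    have h2 := Int.emod_nonneg m hk'.ne'
    have h3 := Int.emod_lt_of_pos m hk'
    have : (k * (m / k) - m).natAbs ≤ k := by omega
    exact this.trans (by nlinarith [Nat.zero_le (k * B)])
  · intro v
    have h1 := htrack (Y (φ.symm v).1) (φ.symm v).2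
    rw [← hφ, Prod.mk.eta, Equiv.apply_symm_apply] at h1
    simp only [hkσ]
    rw [abs_sub_comm]
    linarith
  · rintro ⟨w, m⟩
    have h1 := abs_le.1 (htrack (Y w) (m / k))
    have h2 : (m : ℝ) = ((k * (m / k) : ℤ) : ℝ) + ((m % k : ℤ) : ℝ) := by
      exact_mod_cast (Int.mul_ediv_add_emod m k).symm
    have h3 : (0 : ℝ) ≤ ((m % k : ℤ) : ℝ) := by exact_mod_cast Int.emod_nonneg m hk'.ne'
    have h4 : ((m % k : ℤ) : ℝ) ≤ k := by exact_mod_cast (Int.emod_lt_of_pos m hk').le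
    have hkpos : (0 : ℝ) < k := by exact_mod_cast hk
    have h5 : 0 ≤ σ / k * ((m % k : ℤ) : ℝ) := by positivity
    have h6 : σ / k * ((m % k : ℤ) : ℝ) ≤ σ := by
      calc σ / k * ((m % k : ℤ) : ℝ) ≤ σ / k * k := mul_le_mul_of_nonneg_left h4 (by positivity)
        _ = σ := div_mul_cancel₀ _ hkpos.ne'
    simp only [hφ]
    rw [h2, mul_add, hkσ, abs_le]
    constructor <;> linarith

section Steering

variable {V : Type*}

/-- The ray starting at `y` which follows `up` when it is below the target heights `θ`, and `dn`
otherwise. -/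
noncomputable def trackingRay (h : V → ℝ) (up dn : V → V) (θ : ℕ → ℝ) (y : V) : ℕ → V
  | 0 => y
  | n + 1 =>
    if h (trackingRay h up dn θ y n) < θ n then up (trackingRay h up dn θ y n)
    else dn (trackingRay h up dn θ y n)

lemma abs_trackingRay_sub_le {h : V → ℝ} {up dn : V → V} {θ : ℕ → ℝ} {y : V} {ε H : ℝ}
    (hup : ∀ v, h v + ε ≤ h (up v) ∧ h (up v) ≤ h v + H)
    (hdn : ∀ v, h v - H ≤ h (dn v) ∧ h (dn v) ≤ h v - ε)
    (hθ : ∀ n, |θ (n + 1) - θ n| ≤ ε) (h0 : |h y - θ 0| ≤ H + ε) (n : ℕ) :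
    |h (trackingRay h up dn θ y n) - θ n| ≤ H + ε := by
  induction n with
  | zero => exact h0
  | succ n ih =>
    rw [trackingRay]
    set v := trackingRay h up dn θ y n
    have h1 := hup v
    have h2 := hdn v
    have h3 := abs_le.1 (hθ n)
    rw [abs_le] at ih ⊢
    split_ifs with hv
    · constructor <;> linarith
    · rw [not_lt] at hv
      constructor <;> linarith

/-- The coordinate of `y` on the line `trackingLine h up dn σ y`. -/
noncomputable def trackingBase (h : V → ℝ) (σ : ℝ) (y : V) : ℤ := ⌊h y / σ⌋ + 1

/-- The line with topmost vertex `y` whose point of coordinate `j` has height close to `σ * j`. -/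
noncomputable def trackingLine (h : V → ℝ) (up dn : V → V) (σ : ℝ) (y : V) (j : ℤ) : V :=
  if trackingBase h σ y ≤ j then
    trackingRay h up dn (fun n => σ * (trackingBase h σ y + n)) y (j - trackingBase h σ y).toNat
  else
    trackingRay h up dn (fun n => σ * (trackingBase h σ y - 1 - n)) y
      (trackingBase h σ y - j).toNat

variable {h : V → ℝ} {up dn : V → V} {σ : ℝ}

lemma lt_mul_trackingBase (hσ : 0 < σ) (y : V) : h y < σ * trackingBase h σ y := by
  have := Int.lt_floor_add_one (h y / σ)
  rw [div_lt_iff₀ hσ] at this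
  rw [trackingBase]
  push_cast
  linarith

lemma mul_trackingBase_sub_one_le (hσ : 0 < σ) (y : V) :
    σ * (trackingBase h σ y - 1) ≤ h y := by
  have := Int.floor_le (h y / σ)
  rw [le_div_iff₀ hσ] at this
  rw [trackingBase]
  push_cast
  linarith

lemma trackingLine_add (y : V) (n : ℕ) :
    trackingLine h up dn σ y (trackingBase h σ y + n) =
      trackingRay h up dn (fun n => σ * (trackingBase h σ y + n)) y n := by
  simp [trackingLine]

lemma trackingLine_sub (y : V) (n : ℕ) :
    trackingLine h up dn σ y (trackingBase h σ y - n) =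
      trackingRay h up dn (fun n => σ * (trackingBase h σ y - 1 - n)) y n := by
  rcases Nat.eq_zero_or_pos n with rfl | hn
  · simp [trackingLine, trackingRay]
  · rw [trackingLine, if_neg (by omega)]
    congr
    omega

lemma abs_trackingLine_sub_le {ε H : ℝ} (hσ : 0 < σ) (hσε : σ ≤ ε) (hH : 0 ≤ H)
    (hup : ∀ v, h v + ε ≤ h (up v) ∧ h (up v) ≤ h v + H)
    (hdn : ∀ v, h v - H ≤ h (dn v) ∧ h (dn v) ≤ h v - ε) (y : V) (j : ℤ) :
    |h (trackingLine h up dn σ y j) - σ * j| ≤ H + 2 * ε := by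
  have h1 := lt_mul_trackingBase (h := h) hσ y
  have h2 := mul_trackingBase_sub_one_le (h := h) hσ y
  rcases le_total (trackingBase h σ y) j with hj | hj
  · obtain ⟨n, rfl⟩ := Int.le.dest hj
    rw [trackingLine_add]
    have := abs_trackingRay_sub_le (θ := fun n => σ * (trackingBase h σ y + n)) (y := y) hup hdn
      (fun n => by
        push_cast
        rw [show σ * (trackingBase h σ y + (n + 1)) - σ * (trackingBase h σ y + n) = σ by ring,
          abs_of_pos hσ]
        exact hσε)
      (by
        push_cast
        rw [abs_le]
        constructor <;> linarith) n
    push_cast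
    linarith
  · obtain ⟨n, hn⟩ := Int.le.dest hj
    obtain rfl : j = trackingBase h σ y - n := by omega
    rw [trackingLine_sub]
    have := abs_trackingRay_sub_le (θ := fun n => σ * (trackingBase h σ y - 1 - n)) (y := y) hup hdn
      (fun n => by
        push_cast
        rw [show σ * (trackingBase h σ y - 1 - (n + 1)) - σ * (trackingBase h σ y - 1 - n) = -σ by
          ring, abs_neg, abs_of_pos hσ]
        exact hσε)
      (by
        push_cast
        rw [abs_le]
        constructor <;> linarith) n
    rw [abs_le] at this ⊢
    push_cast
    constructor <;> linarith

lemma trackingRay_succ_eq (θ : ℕ → ℝ) (y : V) (n : ℕ) :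
    trackingRay h up dn θ y (n + 1) = up (trackingRay h up dn θ y n) ∨
      trackingRay h up dn θ y (n + 1) = dn (trackingRay h up dn θ y n) := by
  rw [trackingRay]
  split_ifs <;> simp

lemma lineFamily_trackingLine {G : SimpleGraph V} {o : V} {par : V → V} {dp : V → ℕ}
    (T : IsRootedTree G o par dp) {ε : ℝ} (hσ : 0 < σ) (hε : 0 < ε)
    (hup : ∀ v, h v + ε ≤ h (up v)) (hdn : ∀ v, h (dn v) ≤ h v - ε)
    (hupc : ∀ v, up v ∈ children o par v) (hdnc : ∀ v, dn v ∈ children o par v) :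
    LineFamily o par dp (trackingLine h up dn σ) (trackingBase h σ) := by
  set x := trackingLine h up dn σ with hx
  set b := trackingBase h σ with hb
  have hray : ∀ θ y n, trackingRay h up dn θ y (n + 1) ∈
      children o par (trackingRay h up dn θ y n) := fun θ y n => by
    rcases trackingRay_succ_eq (h := h) (up := up) (dn := dn) θ y n with h1 | h1 <;> rw [h1]
    exacts [hupc _, hdnc _]
  have hdepth : ∀ θ y n, dp (trackingRay h up dn θ y n) = dp y + n := fun θ y n => by
    induction n with
    | zero => rfl
    | succ n ih =>
      obtain ⟨h1, h2⟩ := hray θ y n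
      rw [T.depth_par _ h1, h2, ih, add_assoc]
  have hsucc : ∀ y j, b y ≤ j → x y (j + 1) ∈ children o par (x y j) := by
    intro y j hj
    obtain ⟨n, rfl⟩ := Int.le.dest hj
    have := trackingLine_add (h := h) (up := up) (dn := dn) (σ := σ) y (n + 1)
    push_cast at this
    rw [← add_assoc] at this
    rw [hx, hb, this, trackingLine_add]
    exact hray _ _ _
  have hpred : ∀ y j, j ≤ b y → x y (j - 1) ∈ children o par (x y j) := by
    intro y j hj
    obtain ⟨n, hn⟩ := Int.le.dest hj
    obtain rfl : j = b y - n := by omega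
    have := trackingLine_sub (h := h) (up := up) (dn := dn) (σ := σ) y (n + 1)
    push_cast at this
    rw [← sub_sub] at this
    rw [hx, hb, this, trackingLine_sub]
    exact hray _ _ _
  have hdepth' : ∀ y j, dp (x y j) = dp y + (j - b y).natAbs := by
    intro y j
    rcases le_total (b y) j with hj | hj
    · obtain ⟨n, rfl⟩ := Int.le.dest hj
      rw [hx, hb, trackingLine_add, hdepth]
      simp
    · obtain ⟨n, hn⟩ := Int.le.dest hj
      obtain rfl : j = b y - n := by omega
      rw [hx, hb, trackingLine_sub, hdepth]
      simp
  have hbase : ∀ y, x y (b y) = y := fun y => by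
    have := trackingLine_add (h := h) (up := up) (dn := dn) (σ := σ) y 0
    simpa [trackingRay] using this
  have hfork : ∀ y, x y (b y + 1) = up y ∧ x y (b y - 1) = dn y := by
    intro y
    have h1 := lt_mul_trackingBase (h := h) hσ y
    have h2 := mul_trackingBase_sub_one_le (h := h) hσ y
    have h3 := trackingLine_add (h := h) (up := up) (dn := dn) (σ := σ) y 1
    have h4 := trackingLine_sub (h := h) (up := up) (dn := dn) (σ := σ) y 1
    constructor
    · simpa [trackingRay, h1] using h3
    · simpa [trackingRay, h2.not_gt] using h4
  have hdisj : ∀ y (n : ℕ), x y (b y + (n + 1)) ≠ x y (b y - (n + 1)) := by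
    intro y n
    induction n with
    | zero =>
      intro h1
      simp only [Nat.cast_zero, zero_add] at h1
      rw [(hfork y).1, (hfork y).2] at h1
      have h2 := hup y
      have h3 := hdn y
      rw [h1] at h2
      linarith
    | succ n ih =>
      intro h1
      apply ih
      have h2 := (hsucc y (b y + (n + 1)) (by omega)).2
      have h3 := (hpred y (b y - (n + 1)) (by omega)).2
      rw [← h2, ← h3]
      congr 1
      rw [sub_sub, add_assoc]
      exact_mod_cast h1
  refine ⟨hbase, fun y j hj => (hsucc y j hj).1, fun y j hj => (hsucc y j hj).2,
    fun y j hj => (hpred y j hj).1, fun y j hj => (hpred y j hj).2, ?_, hdepth'⟩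
  intro y i j hij
  have h1 := hdepth' y i
  rw [hij, hdepth'] at h1
  by_contra hne
  rcases lt_or_gt_of_ne hne with hlt | hlt
  · apply hdisj y (j - b y - 1).toNat
    rw [show b y + (((j - b y - 1).toNat : ℤ) + 1) = j by omega,
      show b y - (((j - b y - 1).toNat : ℤ) + 1) = i by omega, hij]
  · apply hdisj y (i - b y - 1).toNat
    rw [show b y + (((i - b y - 1).toNat : ℤ) + 1) = i by omega,
      show b y - (((i - b y - 1).toNat : ℤ) + 1) = j by omega, hij]

end Steering

lemma exists_coarseEquiv_lineModel {V : Type*} {G : SimpleGraph V} {o : V} {par : V → V}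
    {dp : V → ℕ} (T : IsRootedTree G o par dp) {k : ℕ} (hk : 0 < k)
    (hfin : ∀ v, (G.neighborSet v).Finite) (hcard : ∀ v, (G.neighborSet v).ncard = k + 2)
    {h : V → ℝ} {ε H : ℝ} (hε : 0 < ε) (hH : ∀ u v, G.Adj u v → |h u - h v| ≤ H)
    (hup : ∀ v, ∃ u u', u ≠ u' ∧ G.Adj v u ∧ G.Adj v u' ∧ h v + ε ≤ h u ∧ h v + ε ≤ h u')
    (hdown : ∀ v, ∃ u u', u ≠ u' ∧ G.Adj v u ∧ G.Adj v u' ∧ h u ≤ h v - ε ∧ h u' ≤ h v - ε) :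
    ∃ τ₀ : ℝ, 0 < τ₀ ∧ ∀ τ, 0 < τ → τ ≤ τ₀ → CoarseEquiv G h lineModel fun a => τ * a.2 := by
  have hchild {v u u' : V} (hne : u ≠ u') (ha : G.Adj v u) (ha' : G.Adj v u') :
      u ∈ children o par v ∨ u' ∈ children o par v := by
    rcases T.eq_par_of_adj v u ha with hu | hu
    · exact Or.inl hu
    rcases T.eq_par_of_adj v u' ha' with hu' | hu'
    · exact Or.inr hu'
    exact absurd (hu.2.symm.trans hu'.2) hne
  have hup' : ∀ v, ∃ u ∈ children o par v, G.Adj v u ∧ h v + ε ≤ h u := by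
    intro v
    obtain ⟨u, u', hne, ha, ha', hu, hu'⟩ := hup v
    rcases hchild hne ha ha' with hc | hc
    exacts [⟨u, hc, ha, hu⟩, ⟨u', hc, ha', hu'⟩]
  have hdown' : ∀ v, ∃ u ∈ children o par v, G.Adj v u ∧ h u ≤ h v - ε := by
    intro v
    obtain ⟨u, u', hne, ha, ha', hu, hu'⟩ := hdown v
    rcases hchild hne ha ha' with hc | hc
    exacts [⟨u, hc, ha, hu⟩, ⟨u', hc, ha', hu'⟩]
  choose up hupc hupa hupε using hup'
  choose dn hdnc hdna hdnε using hdown'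
  have hk' : (0 : ℝ) < k := by exact_mod_cast hk
  have hH0 : 0 ≤ H := (abs_nonneg _).trans (hH _ _ (hupa o))
  refine ⟨ε / k, div_pos hε hk', fun τ hτ hτε => ?_⟩
  have hσ : 0 < τ * k := mul_pos hτ hk'
  have hσε : τ * k ≤ ε := (le_div_iff₀ hk').1 hτε
  have key := (lineFamily_trackingLine T hσ hε hupε hdnε hupc hdnc).coarseEquiv_lineModel T hk hfin
    hcard hH hσ (abs_trackingLine_sub_le hσ hσε hH0
      (fun v => ⟨hupε v, by linarith [(abs_le.1 (hH _ _ (hupa v))).1]⟩)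
      (fun v => ⟨by linarith [(abs_le.1 (hH _ _ (hdna v))).2], hdnε v⟩))
  simpa [mul_div_assoc, hk'.ne'] using key

lemma SimpleGraph.IsTree.exists_isRootedTree {V : Type*} {G : SimpleGraph V} (hT : G.IsTree) :
    ∃ (o : V) (par : V → V) (dp : V → ℕ), IsRootedTree G o par dp := by
  obtain ⟨o⟩ := hT.connected.nonempty
  have hpar : ∀ v, ∃ u, v ≠ o → G.Adj u v ∧ G.dist o v = G.dist o u + 1 := by
    intro v
    by_cases hv : v = o
    · exact ⟨o, fun h => absurd hv h⟩
    obtain ⟨p, hp⟩ := hT.connected.exists_walk_length_eq_dist v o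
    cases p with
    | nil => exact absurd rfl hv
    | @cons _ u _ hadj q =>
      refine ⟨u, fun _ => ⟨hadj.symm, ?_⟩⟩
      rw [SimpleGraph.Walk.length_cons] at hp
      have h₁ := SimpleGraph.dist_le q
      have h₂ := hT.connected.dist_triangle (u := v) (v := u) (w := o)
      rw [SimpleGraph.dist_eq_one_iff_adj.2 hadj] at h₂
      rw [SimpleGraph.dist_comm (u := o), SimpleGraph.dist_comm (u := o)]
      omega
  choose par hpar using hpar
  have huniq {u u' v : V} (hu : G.Adj u v) (hu' : G.Adj u' v) (hd : G.dist o v = G.dist o u + 1)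
      (hd' : G.dist o v = G.dist o u' + 1) : u = u' := by
    obtain ⟨p, hp⟩ := hT.connected.exists_walk_length_eq_dist o u
    obtain ⟨p', hp'⟩ := hT.connected.exists_walk_length_eq_dist o u'
    have hpath : (p.concat hu).IsPath := (p.concat hu).isPath_of_length_eq_dist (by simp [hp, hd])
    have hpath' : (p'.concat hu').IsPath :=
      (p'.concat hu').isPath_of_length_eq_dist (by simp [hp', hd'])
    have := congrArg (fun q : G.Path o v => q.1.penultimate)
      ((hT.isAcyclic.subsingleton_path o v).elim ⟨_, hpath⟩ ⟨_, hpath'⟩)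
    simpa using this
  have hne {u v : V} (hd : G.dist o v = G.dist o u + 1) : v ≠ o := by
    rintro rfl
    simp at hd
  refine ⟨o, par, G.dist o, hT.connected, SimpleGraph.dist_self, fun v hv => (hpar v hv).1,
    fun v hv => (hpar v hv).2, fun u v huv => ?_⟩
  rcases hT.dist_eq_dist_add_one_of_adj o huv with hd | hd
  · have := hne hd
    exact Or.inr ⟨this, huniq (hpar u this).1 huv.symm (hpar u this).2 hd⟩
  · have := hne hd
    exact Or.inl ⟨this, huniq (hpar v this).1 huv (hpar v this).2 hd⟩

lemma FreeGroup.toWord_mul_mk_singleton {α : Type*} [DecidableEq α] (g : FreeGroup α)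
    (x : α × Bool) : (g * mk [x]).toWord = g.toWord ++ [x] ∨
      g.toWord = (g * mk [x]).toWord ++ [(x.1, !x.2)] := by
  by_cases hr : IsReduced (g.toWord ++ [x])
  · left
    rw [toWord_mul, toWord_mk, (IsReduced.singleton (a := x)).reduce_eq, hr.reduce_eq]
  · right
    have hg : IsReduced g.toWord := isReduced_toWord
    rcases List.eq_nil_or_concat' g.toWord with hw | ⟨w, y, hw⟩
    · rw [hw] at hr
      exact absurd (IsReduced.singleton (a := x)) hr
    have hwr : IsReduced w := by
      rw [hw] at hg
      exact hg.left_of_append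
    have hy : y = (x.1, !x.2) := by
      by_contra hne
      refine hr ?_
      rw [hw] at hg ⊢
      unfold IsReduced at hg ⊢
      refine List.isChain_append.2 ⟨hg, by simp, ?_⟩
      rcases x with ⟨i, a⟩
      rcases y with ⟨j, b⟩
      simp at hne ⊢
      cases a <;> cases b <;> simp_all
    subst hy
    have hmul : g * mk [x] = mk w := by
      rw [← mk_toWord (x := g), hw, ← mul_mk, mul_assoc]
      have : mk [(x.1, !x.2)] * mk [x] = 1 := inv_mul_cancel (mk [x])
      rw [this, mul_one]
    rw [hmul, toWord_mk, hwr.reduce_eq, hw]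

lemma T22_adj_iff (g g' : FreeGroup Bool) :
    T22.Adj g g' ↔ ∃ x : Bool × Bool, g' = g * FreeGroup.mk [x] := by
  have hinv (i : Bool) : (FreeGroup.mk [(i, true)])⁻¹ = FreeGroup.mk [(i, false)] := rfl
  have hne (x : Bool × Bool) : FreeGroup.mk [x] ≠ 1 := by
    intro h
    have := congrArg FreeGroup.toWord h
    simp [FreeGroup.toWord_mk] at this
  simp only [T22, SimpleGraph.fromRel_adj, FreeGroup.of]
  constructor
  · rintro ⟨-, ⟨i, rfl⟩ | ⟨i, rfl⟩⟩
    · exact ⟨_, rfl⟩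
    · exact ⟨(i, false), by rw [← hinv, mul_inv_cancel_right]⟩
  · rintro ⟨⟨i, b⟩, rfl⟩
    refine ⟨fun h => hne (i, b) (by simpa using h.symm), ?_⟩
    cases b
    · exact Or.inr ⟨i, by rw [← hinv, inv_mul_cancel_right]⟩
    · exact Or.inl ⟨i, rfl⟩

lemma T22_isRootedTree :
    IsRootedTree T22 1 (fun g => FreeGroup.mk g.toWord.dropLast) FreeGroup.norm := by
  have hadj : ∀ v : FreeGroup Bool, v ≠ 1 → T22.Adj (FreeGroup.mk v.toWord.dropLast) v := by
    intro v hv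
    have hw : v.toWord ≠ [] := mt FreeGroup.toWord_eq_nil_iff.1 hv
    refine (T22_adj_iff _ _).2 ⟨v.toWord.getLast hw, ?_⟩
    rw [FreeGroup.mul_mk, List.dropLast_append_getLast, FreeGroup.mk_toWord]
  have hnorm : ∀ v : FreeGroup Bool, v ≠ 1 →
      v.norm = (FreeGroup.mk v.toWord.dropLast).norm + 1 := by
    intro v hv
    have hw : v.toWord ≠ [] := mt FreeGroup.toWord_eq_nil_iff.1 hv
    have hr : FreeGroup.IsReduced v.toWord.dropLast :=
      FreeGroup.isReduced_toWord.infix (List.dropLast_prefix _).isInfix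
    rw [FreeGroup.norm, FreeGroup.norm, FreeGroup.toWord_mk, hr.reduce_eq, List.length_dropLast]
    have := List.length_pos_of_ne_nil hw
    omega
  have hreach : ∀ (n : ℕ) (v : FreeGroup Bool), v.norm = n → T22.Reachable 1 v := by
    intro n
    induction n with
    | zero =>
      intro v hv
      rw [FreeGroup.norm_eq_zero.1 hv]
    | succ n ih =>
      intro v hv
      have hv1 : v ≠ 1 := by
        rintro rfl
        simp at hv
      have := hnorm v hv1
      exact (ih _ (by omega)).trans (hadj v hv1).reachable
  refine ⟨⟨fun u v => (hreach _ u rfl).symm.trans (hreach _ v rfl)⟩, FreeGroup.norm_one, hadj,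
    hnorm, fun u v huv => ?_⟩
  obtain ⟨x, rfl⟩ := (T22_adj_iff u v).1 huv
  rcases FreeGroup.toWord_mul_mk_singleton u x with h | h
  · left
    refine ⟨fun h1 => ?_, ?_⟩
    · rw [h1] at h
      simp at h
    · simp [h, FreeGroup.mk_toWord]
  · right
    refine ⟨fun h1 => ?_, ?_⟩
    · rw [h1] at h
      simp at h
    · simp [h, FreeGroup.mk_toWord]

lemma T22_neighborSet (g : FreeGroup Bool) :
    T22.neighborSet g = Set.range fun x : Bool × Bool => g * FreeGroup.mk [x] := by
  ext g'
  simp [T22_adj_iff, eq_comm]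

lemma mul_mk_singleton_injective (g : FreeGroup Bool) :
    Function.Injective fun x : Bool × Bool => g * FreeGroup.mk [x] := by
  intro x y hxy
  have := congrArg FreeGroup.toWord (mul_left_cancel hxy)
  simpa [FreeGroup.toWord_mk] using this

lemma h22_mul_mk (g : FreeGroup Bool) (i b : Bool) :
    h22 (g * FreeGroup.mk [(i, b)]) = h22 g + if b then 1 else -1 := by
  cases b <;> simp [h22]

lemma T22_exists_coarseEquiv_lineModel :
    ∃ τ₀ : ℝ, 0 < τ₀ ∧ ∀ τ, 0 < τ → τ ≤ τ₀ → CoarseEquiv T22 h22 lineModel fun a => τ * a.2 := by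
  refine exists_coarseEquiv_lineModel T22_isRootedTree (k := 2) two_pos (fun v => ?_) (fun v => ?_)
    (ε := 1) (H := 1) one_pos (fun u v huv => ?_)
    (fun v => ⟨v * FreeGroup.mk [(true, true)], v * FreeGroup.mk [(false, true)], ?_, ?_, ?_, ?_⟩)
    (fun v => ⟨v * FreeGroup.mk [(true, false)], v * FreeGroup.mk [(false, false)], ?_, ?_, ?_, ?_⟩)
  · rw [T22_neighborSet]
    exact Set.finite_range _
  · rw [T22_neighborSet, ← Set.image_univ,
      Set.ncard_image_of_injective _ (mul_mk_singleton_injective v), Set.ncard_univ]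
    simp
  · obtain ⟨⟨i, b⟩, rfl⟩ := (T22_adj_iff u v).1 huv
    rw [h22_mul_mk]
    cases b <;> simp
  · exact fun h => by simpa using mul_mk_singleton_injective v h
  · exact (T22_adj_iff _ _).2 ⟨_, rfl⟩
  · exact (T22_adj_iff _ _).2 ⟨_, rfl⟩
  · simp [h22_mul_mk]
  · exact fun h => by simpa using mul_mk_singleton_injective v h
  · exact (T22_adj_iff _ _).2 ⟨_, rfl⟩
  · exact (T22_adj_iff _ _).2 ⟨_, rfl⟩
  · simp [h22_mul_mk, sub_eq_add_neg]

/-- Homogeneity makes the degree constant and the height changes uniformly bounded, from above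
always and away from zero where they do not vanish. -/
lemma Homogeneous.exists_bounds {V : Type*} {G : SimpleGraph V} {h : V → ℝ}
    (hhom : Homogeneous G h) (o : V) (hfin : (G.neighborSet o).Finite) :
    (∀ v, (G.neighborSet v).ncard = (G.neighborSet o).ncard) ∧
      ∃ ε H : ℝ, 0 < ε ∧ ∀ u v, G.Adj u v → |h u - h v| ≤ H ∧ (h u ≠ h v → ε ≤ |h u - h v|) := by
  refine ⟨fun v => ?_, ?_⟩
  · obtain ⟨σ, -⟩ := hhom v o
    exact Nat.card_congr σ
  have hbase : ∀ u v, G.Adj u v → ∃ w ∈ G.neighborSet o, h u - h v = h w - h o := by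
    intro u v huv
    obtain ⟨σ, hσ⟩ := hhom v o
    exact ⟨σ ⟨u, huv.symm⟩, (σ ⟨u, huv.symm⟩).2, hσ ⟨u, huv.symm⟩⟩
  have hε : ∃ ε : ℝ, 0 < ε ∧ ∀ w ∈ G.neighborSet o, h w ≠ h o → ε ≤ |h w - h o| := by
    rcases Set.eq_empty_or_nonempty (G.neighborSet o ∩ {w | h w ≠ h o}) with he | hne
    · exact ⟨1, one_pos, fun w hw hwo => absurd he (Set.Nonempty.ne_empty ⟨w, hw, hwo⟩)⟩
    · obtain ⟨w, hw, hmin⟩ :=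
        Set.exists_min_image _ (fun w => |h w - h o|) (hfin.inter_of_left _) hne
      exact ⟨_, abs_pos.2 (sub_ne_zero.2 hw.2), fun z hz hzo => hmin z ⟨hz, hzo⟩⟩
  obtain ⟨ε, hε, hεw⟩ := hε
  obtain ⟨H, hH⟩ := (hfin.image fun w => |h w - h o|).bddAbove
  refine ⟨ε, H, hε, fun u v huv => ?_⟩
  obtain ⟨w, hw, he⟩ := hbase u v huv
  rw [he, ← sub_ne_zero, he, sub_ne_zero]
  exact ⟨hH ⟨w, hw, rfl⟩, hεw w hw⟩

/-- The Main Lemma: a homogeneous coarsely oriented tree in which every vertex has at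
least two strictly higher neighbors and at least two strictly lower neighbors is
coarsely orientation preserving quasi-isometric to the oriented tree of type `(2,2)`. -/
theorem main_lemma_cop_qi_to_T22 {V : Type*} (G : SimpleGraph V) (h : V → ℝ)
    (hT : G.IsTree) (hlf : ∀ v, (G.neighborSet v).Finite) (hhom : Homogeneous G h)
    (hup : ∀ v : V, ∃ u u' : V, u ≠ u' ∧ G.Adj v u ∧ G.Adj v u' ∧ h v < h u ∧ h v < h u')
    (hdown : ∀ v : V, ∃ u u' : V, u ≠ u' ∧ G.Adj v u ∧ G.Adj v u' ∧ h u < h v ∧ h u' < h v) :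
    ∃ f : V → FreeGroup Bool, IsCOPQuasiIsometry G h T22 h22 f := by
  obtain ⟨o, par, dp, T⟩ := hT.exists_isRootedTree
  obtain ⟨hcard, ε, H, hε, hbound⟩ := hhom.exists_bounds o (hlf o)
  have hdeg : 2 < (G.neighborSet o).ncard := by
    obtain ⟨u, u', hne, ha, ha', hu, hu'⟩ := hup o
    obtain ⟨w, -, -, hb, -, hw, -⟩ := hdown o
    refine (Set.two_lt_ncard (hlf o)).2 ⟨u, ha, u', ha', w, hb, hne, ?_, ?_⟩
    · rintro rfl
      exact lt_asymm hu hw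
    · rintro rfl
      exact lt_asymm hu' hw
  have hge {u v : V} (ha : G.Adj v u) (hlt : h v < h u) : h v + ε ≤ h u := by
    have := (hbound u v ha.symm).2 hlt.ne'
    rw [abs_of_pos (sub_pos.2 hlt)] at this
    linarith
  obtain ⟨τ₁, hτ₁, e₁⟩ := exists_coarseEquiv_lineModel T (Nat.sub_pos_of_lt hdeg) hlf
    (fun v => by rw [hcard v, Nat.sub_add_cancel hdeg.le]) hε (fun u v ha => (hbound u v ha).1)
    (fun v => by
      obtain ⟨u, u', hne, ha, ha', hu, hu'⟩ := hup v
      exact ⟨u, u', hne, ha, ha', hge ha hu, hge ha' hu'⟩)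
    (fun v => by
      obtain ⟨u, u', hne, ha, ha', hu, hu'⟩ := hdown v
      exact ⟨u, u', hne, ha, ha', le_sub_iff_add_le.2 (hge ha.symm hu),
        le_sub_iff_add_le.2 (hge ha'.symm hu')⟩)
  obtain ⟨τ₂, hτ₂, e₂⟩ := T22_exists_coarseEquiv_lineModel
  have hτ : 0 < min τ₁ τ₂ := lt_min hτ₁ hτ₂
  exact CoarseEquiv.exists_isCOPQuasiIsometry hT.connected T22_isRootedTree.connected
    lineModel_connected (e₁ _ hτ (min_le_left _ _)) (e₂ _ hτ (min_le_right _ _))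
end

section
/- For i = 1, 2, let T_i be a coarsely oriented tree in which every vertex has degree exactly n_i, with n_i ≥ 3, and with |h_i(u) − h_i(v)| ≤ M for every edge {u,v}, equipped with a lamination by lines of slope (β_i, C_i) where β_i > 0. Assume β₁/β₂ = (n₁ − 2)/(n₂ − 2). Then there exist K > 0 and a graph isomorphism f : T₁' → T₂' between the quotient trees such that for every edge E of T₁', the unique edge e of T₁ joining the pair of lines forming E and the unique edge e' of T₂ joining the pair of lines forming f(E) satisfy |height(e) − height(e')| ≤ K. -/
/-- A line of slope `(β, C)` in a coarsely oriented tree: a bi-infinite geodesic along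
which the height changes at rate `β` up to an additive error `C`. -/
def IsSlopeLine {V : Type*} (G : SimpleGraph V) (h : V → ℝ) (β C : ℝ) (γ : ℤ → V) : Prop :=
  (∀ n m : ℤ, G.dist (γ n) (γ m) = (n - m).natAbs) ∧
  (∀ n m : ℤ, |h (γ n) - h (γ m) - β * (n - m)| ≤ C)

/-- A lamination of a coarsely oriented tree by lines of slope `(β, C)`: a family of
such lines whose images partition the vertex set, so that exactly one line of the
family passes through each vertex. -/
def IsLamination {V : Type*} {ι : Type*} (G : SimpleGraph V) (h : V → ℝ) (β C : ℝ)
    (L : ι → ℤ → V) : Prop :=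
  (∀ i : ι, IsSlopeLine G h β C (L i)) ∧
  (∀ v : V, ∃! i : ι, v ∈ Set.range (L i))

/-- The quotient graph of a tree with a lamination: vertices are the lines of the
lamination, two lines being adjacent iff some edge of the tree joins them. -/
def quotGraph {V ι : Type*} (G : SimpleGraph V) (L : ι → ℤ → V) : SimpleGraph ι :=
  SimpleGraph.fromRel (fun i j => ∃ n m : ℤ, G.Adj (L i n) (L j m))

/-- For two rooted trees given by parent maps that decrease a depth function, bijections between
the children of any two nodes assemble to a bijection of the nodes. -/
theorem exists_equiv_of_children_equiv {V W : Type*} (r : V) (s : W) (dV : V → ℕ) (dW : W → ℕ)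
    (pV : V → V) (pW : W → W)
    (hV : ∀ v, v ≠ r → dV (pV v) < dV v) (hW : ∀ w, w ≠ s → dW (pW w) < dW w)
    (σ : ∀ x y, {v // v ≠ r ∧ pV v = x} ≃ {w // w ≠ s ∧ pW w = y}) :
    ∃ f : V ≃ W, f r = s ∧ ∀ x v (hv : v ≠ r ∧ pV v = x), f v = σ x (f x) ⟨v, hv⟩ := by
  classical
  obtain ⟨f, hfr, hf⟩ : ∃ f : V → W, f r = s ∧
      ∀ x v (hv : v ≠ r ∧ pV v = x), f v = σ x (f x) ⟨v, hv⟩ := by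
    let F : ∀ v, (∀ u, dV u < dV v → W) → W := fun v g =>
      if hv : v = r then s else σ (pV v) (g (pV v) (hV v hv)) ⟨v, hv, rfl⟩
    refine ⟨(measure dV).wf.fix F, ?_, ?_⟩
    · rw [WellFounded.fix_eq]; simp [F]
    · rintro _ v ⟨hv, rfl⟩
      rw [WellFounded.fix_eq]; simp only [F, dif_neg hv]
  have hne : ∀ v, v ≠ r → f v ≠ s ∧ pW (f v) = f (pV v) := fun v hv => by
    rw [hf _ v ⟨hv, rfl⟩]; exact (σ (pV v) (f (pV v)) ⟨v, hv, rfl⟩).2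
  have hinj : ∀ n u v, dV u = n → f u = f v → u = v := by
    intro n
    induction n using Nat.strong_induction_on with
    | _ n ih =>
      intro u v hn huv
      by_cases hu : u = r
      · by_contra h
        exact (hne v fun hv => h (hu.trans hv.symm)).1 (by rw [← huv, hu, hfr])
      by_cases hv : v = r
      · exact absurd (by rw [huv, hv, hfr]) (hne u hu).1
      have hp : pV u = pV v := ih _ (hn ▸ hV u hu) _ _ rfl
        (by rw [← (hne u hu).2, ← (hne v hv).2, huv])
      have := (σ _ _).injective (Subtype.ext
        ((hf _ u ⟨hu, hp⟩).symm.trans (huv.trans (hf _ v ⟨hv, rfl⟩))))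
      exact congrArg Subtype.val this
  have hsurj : ∀ n w, dW w = n → ∃ v, f v = w := by
    intro n
    induction n using Nat.strong_induction_on with
    | _ n ih =>
      intro w hn
      by_cases hw : w = s
      · exact ⟨r, hfr.trans hw.symm⟩
      obtain ⟨x, hx⟩ := ih _ (hn ▸ hW w hw) (pW w) rfl
      obtain ⟨c, hc⟩ := (σ x (f x)).surjective ⟨w, hw, hx.symm⟩
      exact ⟨c, by rw [hf x c c.2, Subtype.coe_eta, hc]⟩
  exact ⟨Equiv.ofBijective f ⟨fun u v => hinj _ u v rfl, fun w => hsurj _ w rfl⟩, hfr, hf⟩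

theorem SimpleGraph.IsTree.exists_parent {V : Type*} {G : SimpleGraph V} (hG : G.IsTree) (r : V) :
    ∃ p : V → V, (∀ v, v ≠ r → G.Adj (p v) v ∧ G.dist r (p v) < G.dist r v) ∧
      ∀ u v, G.Adj u v → (u ≠ r ∧ p u = v) ∨ (v ≠ r ∧ p v = u) := by
  have hex : ∀ v, ∃ w, v ≠ r → G.Adj w v ∧ G.dist r w + 1 = G.dist r v := by
    intro v
    by_cases hv : v = r
    · exact ⟨v, fun h => absurd hv h⟩
    obtain ⟨q, hq⟩ := hG.connected.exists_walk_length_eq_dist v r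
    cases q with
    | nil => exact absurd rfl hv
    | @cons _ w _ hadj q =>
      refine ⟨w, fun _ => ⟨hadj.symm, ?_⟩⟩
      have h1 := SimpleGraph.dist_le q
      have h2 := hG.dist_eq_dist_add_one_of_adj r hadj
      rw [SimpleGraph.Walk.length_cons, SimpleGraph.dist_comm] at hq
      rw [SimpleGraph.dist_comm] at h1
      omega
  choose p hp using hex
  have huniq : ∀ v w w', G.Adj w v → G.Adj w' v → G.dist r w + 1 = G.dist r v →
      G.dist r w' + 1 = G.dist r v → w = w' := by
    intro v w w' hw hw' hd hd'
    obtain ⟨q, hq⟩ := hG.connected.exists_walk_length_eq_dist r w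
    obtain ⟨q', hq'⟩ := hG.connected.exists_walk_length_eq_dist r w'
    have h1 : (q.concat hw).IsPath := SimpleGraph.Walk.isPath_of_length_eq_dist _ (by simp [hq, hd])
    have h2 : (q'.concat hw').IsPath :=
      SimpleGraph.Walk.isPath_of_length_eq_dist _ (by simp [hq', hd'])
    have := congrArg SimpleGraph.Walk.penultimate ((hG.existsUnique_path r v).unique h1 h2)
    simpa using this
  refine ⟨p, fun v hv => ⟨(hp v hv).1, by have := (hp v hv).2; omega⟩, fun u v huv => ?_⟩
  rcases hG.dist_eq_dist_add_one_of_adj r huv with h | h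
  · have hu : u ≠ r := by rintro rfl; simp at h
    exact .inl ⟨hu, huniq u _ _ (hp u hu).1 huv.symm (hp u hu).2 h.symm⟩
  · have hv : v ≠ r := by rintro rfl; simp at h
    exact .inr ⟨hv, huniq v _ _ (hp v hv).1 huv (hp v hv).2 h.symm⟩

/-- Two trees are isomorphic, along an isomorphism compatible with a relation `R` between their
oriented edges, as soon as `R` matches the edges at any two vertices after leaving out
at most one edge on each side. -/
theorem SimpleGraph.IsTree.exists_iso_of_local_equiv {V W : Type*} {G : SimpleGraph V}
    {H : SimpleGraph W} (hG : G.IsTree) (hH : H.IsTree) (R : V → V → W → W → Prop)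
    (hR : ∀ v w, ∀ S ⊆ G.neighborSet v, ∀ T ⊆ H.neighborSet w,
      (G.neighborSet v \ S).Subsingleton → (H.neighborSet w \ T).Subsingleton →
      ∃ e : S ≃ T, ∀ x : S, R v x w (e x)) :
    ∃ f : G ≃g H, ∀ u v, G.Adj u v → R u v (f u) (f v) ∨ R v u (f v) (f u) := by
  obtain ⟨r⟩ := hG.connected.nonempty
  obtain ⟨s⟩ := hH.connected.nonempty
  obtain ⟨p, hp, hpadj⟩ := hG.exists_parent r
  obtain ⟨q, hq, hqadj⟩ := hH.exists_parent s
  have hσ : ∀ x y, ∃ e : {v | v ≠ r ∧ p v = x} ≃ {w | w ≠ s ∧ q w = y},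
      ∀ v : {v | v ≠ r ∧ p v = x}, R x v y (e v) := by
    intro x y
    refine hR x y _ ?_ _ ?_ ?_ ?_
    · rintro v ⟨hv, rfl⟩; exact (hp v hv).1
    · rintro v ⟨hv, rfl⟩; exact (hq v hv).1
    · have : ∀ v ∈ G.neighborSet x \ {v | v ≠ r ∧ p v = x}, v = p x := by
        rintro v ⟨hv, hv'⟩
        rcases hpadj x v hv with h | h
        exacts [h.2.symm, absurd h hv']
      exact fun a ha b hb => (this a ha).trans (this b hb).symm
    · have : ∀ v ∈ H.neighborSet y \ {v | v ≠ s ∧ q v = y}, v = q y := by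
        rintro v ⟨hv, hv'⟩
        rcases hqadj y v hv with h | h
        exacts [h.2.symm, absurd h hv']
      exact fun a ha b hb => (this a ha).trans (this b hb).symm
  choose σ hσ using hσ
  obtain ⟨f, hfr, hf⟩ := exists_equiv_of_children_equiv r s (G.dist r) (H.dist s) p q
    (fun v hv => (hp v hv).2) (fun w hw => (hq w hw).2) σ
  have hne : ∀ v, v ≠ r → f v ≠ s ∧ q (f v) = f (p v) := fun v hv => by
    rw [hf _ v ⟨hv, rfl⟩]; exact (σ (p v) (f (p v)) ⟨v, hv, rfl⟩).2
  have hRf : ∀ v, v ≠ r → R (p v) v (f (p v)) (f v) := fun v hv => by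
    conv => arg 4; rw [hf _ v ⟨hv, rfl⟩]
    exact hσ (p v) (f (p v)) ⟨v, hv, rfl⟩
  have hfp : ∀ v, v ≠ r → H.Adj (f (p v)) (f v) := fun v hv => by
    rw [← (hne v hv).2]; exact (hq _ (hne v hv).1).1
  have hback : ∀ a b, f b ≠ s → q (f b) = f a → G.Adj a b := by
    intro a b hb hab
    have hbr : b ≠ r := by rintro rfl; exact hb hfr
    rw [(hne b hbr).2] at hab
    exact f.injective hab ▸ (hp b hbr).1
  refine ⟨⟨f, fun {a b} => ⟨fun h => ?_, fun h => ?_⟩⟩, fun u v huv => ?_⟩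
  · rcases hqadj _ _ h with ⟨h1, h2⟩ | ⟨h1, h2⟩
    exacts [(hback b a h1 h2).symm, hback a b h1 h2]
  · rcases hpadj _ _ h with ⟨h1, rfl⟩ | ⟨h1, rfl⟩
    exacts [(hfp _ h1).symm, hfp _ h1]
  · rcases hpadj _ _ huv with ⟨h1, rfl⟩ | ⟨h1, rfl⟩
    exacts [.inr (hRf _ h1), .inl (hRf _ h1)]

theorem exists_equiv_int_of_fiber_card {X : Type*} (p : X → ℤ) (d : ℕ) (hd : d ≠ 0)
    (hp : ∀ k, Nat.card {x // p x = k} = d) : ∃ e : ℤ ≃ X, ∀ k, p (e k) = k / d := by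
  have : NeZero d := ⟨hd⟩
  have hfib : ∀ k, Nonempty (Fin d ≃ {x // p x = k}) := fun k => by
    have : Finite {x // p x = k} := Nat.finite_of_card_ne_zero (by rw [hp]; exact hd)
    exact ⟨(Finite.equivFinOfCardEq (hp k)).symm⟩
  let ψ : ∀ k, Fin d ≃ {x // p x = k} := fun k => (hfib k).some
  refine ⟨(Int.divModEquiv d).trans
    ((Equiv.sigmaEquivProd ℤ (Fin d)).symm.trans
      ((Equiv.sigmaCongrRight ψ).trans (Equiv.sigmaFiberEquiv p))), fun k => ?_⟩
  exact (ψ (k / d) _).2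

theorem exists_equiv_int_of_diff_subsingleton {X : Type*} {N S : Set X} (e : ℤ ≃ N) (hS : S ⊆ N)
    (hN : (N \ S).Subsingleton) :
    ∃ e' : ℤ ≃ S, ∀ k, ∃ t, (t = k ∨ t = k + 1) ∧ (e' k : X) = e t := by
  classical
  rcases hN.eq_empty_or_singleton with h | ⟨a, ha⟩
  · obtain rfl : N = S := (Set.sdiff_eq_empty.1 h).antisymm hS
    exact ⟨e, fun k => ⟨k, .inl rfl, rfl⟩⟩
  have haN : a ∈ N \ S := ha ▸ rfl
  let b : ℤ := e.symm ⟨a, haN.1⟩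
  have hb : (e b : X) = a := by simp [b]
  let g : ℤ → ℤ := fun k => if k < b then k else k + 1
  have hg : ∀ k, (e (g k) : X) ∈ S := fun k => by
    by_contra h
    have h1 : (e (g k) : X) ∈ N \ S := ⟨(e (g k)).2, h⟩
    rw [ha, Set.mem_singleton_iff, ← hb] at h1
    have h2 := e.injective (Subtype.ext h1)
    simp only [g] at h2
    split_ifs at h2 <;> omega
  refine ⟨Equiv.ofBijective (fun k => ⟨e (g k), hg k⟩) ⟨fun k l hkl => ?_, fun x => ?_⟩, fun k => ?_⟩
  · have := e.injective (Subtype.ext (Subtype.mk.inj hkl))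
    simp only [g] at this
    split_ifs at this <;> omega
  · obtain ⟨t, ht⟩ := e.surjective ⟨x, hS x.2⟩
    have htb : t ≠ b := by
      rintro rfl
      rw [ht] at hb
      exact haN.2 (hb ▸ x.2)
    have : ∃ k, g k = t := by
      by_cases h : t < b
      · exact ⟨t, by simp [g, h]⟩
      · exact ⟨t - 1, by simp only [g]; split_ifs <;> omega⟩
    obtain ⟨k, rfl⟩ := this
    exact ⟨k, Subtype.ext (by simp [ht])⟩
  · refine ⟨g k, ?_, rfl⟩
    simp only [g]; split_ifs <;> simp

theorem SimpleGraph.reachable_of_adj_add_one {V : Type*} {G : SimpleGraph V} {γ : ℤ → V}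
    (hγ : ∀ k, G.Adj (γ k) (γ (k + 1))) (k l : ℤ) : G.Reachable (γ k) (γ l) := by
  have : ∀ k, G.Reachable (γ 0) (γ k) := fun k => by
    induction k using Int.induction_on with
    | zero => rfl
    | succ k ih => exact ih.trans (hγ _).reachable
    | pred k ih =>
      have := hγ (-(k : ℤ) - 1)
      rw [sub_add_cancel] at this
      exact ih.trans this.symm.reachable
  exact (this k).symm.trans (this l)

section Lamination

variable {V ι : Type*} {G : SimpleGraph V} {h : V → ℝ} {β C : ℝ} {L : ι → ℤ → V}

theorem IsSlopeLine.injective {γ : ℤ → V} (hγ : IsSlopeLine G h β C γ) :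
    Function.Injective γ := fun a b hab => by
  have := hγ.1 a b
  rw [hab, SimpleGraph.dist_self] at this
  omega

theorem IsSlopeLine.adj_succ {γ : ℤ → V} (hγ : IsSlopeLine G h β C γ) (k : ℤ) :
    G.Adj (γ k) (γ (k + 1)) := by
  rw [← SimpleGraph.dist_eq_one_iff_adj, hγ.1]; omega

theorem quotGraph_adj {i j : ι} :
    (quotGraph G L).Adj i j ↔ i ≠ j ∧ ∃ n m, G.Adj (L i n) (L j m) := by
  rw [quotGraph, SimpleGraph.fromRel_adj]
  refine and_congr_right fun _ => ⟨?_, .inl⟩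
  rintro (h | ⟨n, m, h⟩)
  exacts [h, ⟨m, n, h.symm⟩]

namespace IsLamination

theorem index_eq (hL : IsLamination G h β C L) {a b : ι} {k l : ℤ} (hab : L a k = L b l) :
    a = b :=
  (hL.2 (L a k)).unique ⟨k, rfl⟩ ⟨l, hab.symm⟩

/-- Removing an edge between two different lines of a laminated forest separates these lines
from each other, also in the quotient. -/
theorem not_reachable_of_adj (hG : G.IsAcyclic) (hL : IsLamination G h β C L) {i j : ι}
    (hij : i ≠ j) {n m : ℤ} (hadj : G.Adj (L i n) (L j m)) (H : SimpleGraph ι)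
    (hH : ∀ a b, H.Adj a b →
      ∃ k l, (G.deleteEdges {s(L i n, L j m)}).Adj (L a k) (L b l)) :
    ¬ H.Reachable i j := by
  have hline : ∀ a k l, (G.deleteEdges {s(L i n, L j m)}).Reachable (L a k) (L a l) :=
    fun a => SimpleGraph.reachable_of_adj_add_one fun k => by
      rw [SimpleGraph.deleteEdges_adj]
      refine ⟨(hL.1 a).adj_succ k, fun he => ?_⟩
      rw [Set.mem_singleton_iff, Sym2.eq_iff] at he
      rcases he with ⟨h1, h2⟩ | ⟨h1, h2⟩
      · exact hij ((hL.index_eq h1).symm.trans (hL.index_eq h2))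
      · exact hij ((hL.index_eq h2).symm.trans (hL.index_eq h1))
  have key : ∀ a b, H.Reachable a b →
      ∀ k l, (G.deleteEdges {s(L i n, L j m)}).Reachable (L a k) (L b l) := by
    rintro a b ⟨p⟩
    induction p with
    | nil => exact hline _
    | cons hab _ ih =>
      intro k l
      obtain ⟨k', l', hkl⟩ := hH _ _ hab
      exact ((hline _ k k').trans hkl.reachable).trans (ih l' l)
  intro hr
  have hb := SimpleGraph.isAcyclic_iff_forall_adj_isBridge.1 hG hadj
  rw [SimpleGraph.isBridge_iff] at hb
  exact absurd (key i j hr n m) (by tauto)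

theorem edge_unique (hG : G.IsAcyclic) (hL : IsLamination G h β C L) {i j : ι} (hij : i ≠ j)
    {n m n' m' : ℤ} (h1 : G.Adj (L i n) (L j m)) (h2 : G.Adj (L i n') (L j m')) :
    n = n' ∧ m = m' := by
  by_contra hne
  refine hL.not_reachable_of_adj hG hij h1 (SimpleGraph.fromEdgeSet {s(i, j)}) ?_
    (SimpleGraph.Adj.reachable (by simp [hij]))
  have hd : (G.deleteEdges {s(L i n, L j m)}).Adj (L i n') (L j m') := by
    rw [SimpleGraph.deleteEdges_adj]
    refine ⟨h2, fun he => ?_⟩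
    rw [Set.mem_singleton_iff, Sym2.eq_iff] at he
    rcases he with ⟨h3, h4⟩ | ⟨h3, -⟩
    · exact hne ⟨((hL.1 i).injective h3).symm, ((hL.1 j).injective h4).symm⟩
    · exact hij (hL.index_eq h3)
  intro a b hab
  rw [SimpleGraph.fromEdgeSet_adj, Set.mem_singleton_iff, Sym2.eq_iff] at hab
  rcases hab.1 with ⟨rfl, rfl⟩ | ⟨rfl, rfl⟩
  exacts [⟨_, _, hd⟩, ⟨_, _, hd.symm⟩]

theorem quotGraph_isTree (hG : G.IsTree) (hL : IsLamination G h β C L) :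
    (quotGraph G L).IsTree := by
  refine ⟨?_, ?_⟩
  · have key : ∀ u v, G.Reachable u v → ∀ a b k l, L a k = u → L b l = v →
        (quotGraph G L).Reachable a b := by
      rintro u v ⟨p⟩
      induction p with
      | nil =>
        rintro a b k l rfl hv
        rw [hL.index_eq hv]
      | @cons u w v huw _ ih =>
        rintro a b k l rfl hv
        obtain ⟨c, ⟨t, rfl⟩, -⟩ := hL.2 w
        refine .trans ?_ (ih c b t l rfl hv)
        by_cases hac : a = c
        · rw [hac]
        · exact (quotGraph_adj.2 ⟨hac, _, _, huw⟩ : (quotGraph G L).Adj a c).reachable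
    have : Nonempty ι := by
      obtain ⟨v⟩ := hG.connected.nonempty
      exact ⟨(hL.2 v).choose⟩
    exact SimpleGraph.connected_iff _ |>.2
      ⟨fun a b => key _ _ (hG.connected (L a 0) (L b 0)) a b 0 0 rfl rfl, this⟩
  · rw [SimpleGraph.isAcyclic_iff_forall_adj_isBridge]
    intro i j hij
    obtain ⟨hne, n, m, hadj⟩ := quotGraph_adj.1 hij
    rw [SimpleGraph.isBridge_iff]
    have := hL.not_reachable_of_adj hG.isAcyclic hne hadj
      ((quotGraph G L).deleteEdges {s(i, j)}) (fun a b hab => by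
        rw [SimpleGraph.deleteEdges_adj] at hab
        obtain ⟨-, k, l, hkl⟩ := quotGraph_adj.1 hab.1
        refine ⟨k, l, ?_⟩
        rw [SimpleGraph.deleteEdges_adj]
        refine ⟨hkl, fun he => hab.2 ?_⟩
        rw [Set.mem_singleton_iff, Sym2.eq_iff] at he ⊢
        exact he.imp (And.imp hL.index_eq hL.index_eq) (And.imp hL.index_eq hL.index_eq))
    tauto

/-- At each vertex of a line, all but two edges lead to other lines. -/
theorem card_position_fiber (hG : G.IsAcyclic) (hL : IsLamination G h β C L) {d : ℕ}
    (hdeg : ∀ v, (G.neighborSet v).ncard = d + 2) (i : ι)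
    (p q : (quotGraph G L).neighborSet i → ℤ) (hpq : ∀ x, G.Adj (L i (p x)) (L x (q x))) (k : ℤ) :
    Nat.card {x // p x = k} = d := by
  have hpos : ∀ (x : (quotGraph G L).neighborSet i) n m, G.Adj (L i n) (L x m) →
      p x = n ∧ q x = m := fun x n m hx =>
    hL.edge_unique hG (quotGraph_adj.1 x.2).1 (hpq x) hx
  have hpm : L i (k + 1) ≠ L i (k - 1) := fun he => by
    have := (hL.1 i).injective he
    omega
  have hsub : {L i (k + 1), L i (k - 1)} ⊆ G.neighborSet (L i k) := by
    have := (hL.1 i).adj_succ (k - 1)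
    rw [sub_add_cancel] at this
    rintro _ (rfl | rfl)
    exacts [(hL.1 i).adj_succ k, this.symm]
  have hcard : (G.neighborSet (L i k) \ {L i (k + 1), L i (k - 1)}).ncard = d := by
    rw [Set.ncard_sdiff hsub, hdeg, Set.ncard_pair hpm, Nat.add_sub_cancel]
  rw [← hcard, ← Nat.card_coe_set_eq]
  refine Nat.card_congr (Equiv.ofBijective (fun x => ⟨L x.1 (q x.1), ?_, ?_⟩) ⟨?_, ?_⟩)
  · exact (congrArg (fun k => G.Adj (L i k) _) x.2).mp (hpq x.1)
  · have hne := (quotGraph_adj.1 x.1.2).1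
    rintro (he | he)
    exacts [hne (hL.index_eq he).symm, hne (hL.index_eq he).symm]
  · intro x y hxy
    exact Subtype.ext (Subtype.ext (hL.index_eq (congrArg Subtype.val hxy)))
  · rintro ⟨w, hw, hw'⟩
    obtain ⟨j, ⟨m, rfl⟩, -⟩ := hL.2 w
    have hij : i ≠ j := by
      rintro rfl
      have h1 := (hL.1 i).1 k m
      rw [SimpleGraph.dist_eq_one_iff_adj.2 hw] at h1
      apply hw'
      obtain rfl | rfl : m = k + 1 ∨ m = k - 1 := by omega
      exacts [.inl rfl, .inr rfl]
    obtain ⟨h1, h2⟩ := hpos ⟨j, quotGraph_adj.2 ⟨hij, k, m, hw⟩⟩ k m hw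
    exact ⟨⟨_, h1⟩, Subtype.ext (by simp [h2])⟩

/-- The edges leaving a line, possibly with one of them left out, can be enumerated by `ℤ` so that
their heights form an arithmetic progression up to a uniformly bounded error. -/
theorem exists_enumeration (hG : G.IsAcyclic) (hL : IsLamination G h β C L) (hβ : 0 < β)
    {M : ℝ} (hM : ∀ u v, G.Adj u v → |h u - h v| ≤ M) {d : ℕ} (hd : d ≠ 0)
    (hdeg : ∀ v, (G.neighborSet v).ncard = d + 2) (i : ι) (S : Set ι)
    (hS : S ⊆ (quotGraph G L).neighborSet i)
    (hS' : ((quotGraph G L).neighborSet i \ S).Subsingleton) :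
    ∃ c : ℝ, ∃ e : ℤ ≃ S, ∀ k n m, G.Adj (L i n) (L (e k) m) →
      |max (h (L i n)) (h (L (e k) m)) - (c + β / d * k)| ≤ M + C + 2 * β := by
  choose p q hpq using fun x : (quotGraph G L).neighborSet i => (quotGraph_adj.1 x.2).2
  obtain ⟨e, he⟩ := exists_equiv_int_of_fiber_card p d hd
    (hL.card_position_fiber hG hdeg i p q hpq)
  obtain ⟨e', he'⟩ := exists_equiv_int_of_diff_subsingleton e hS hS'
  refine ⟨h (L i 0), e', fun k n m hadj => ?_⟩
  obtain ⟨t, ht, hkt⟩ := he' k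
  rw [hkt] at hadj ⊢
  obtain ⟨rfl, -⟩ := hL.edge_unique hG (quotGraph_adj.1 (e t).2).1 (hpq (e t)) hadj
  rw [he] at hadj ⊢
  have hdpos : (0 : ℝ) < d := by positivity
  have h1 := abs_le.1 ((hL.1 i).2 (t / d) 0)
  have h2 := abs_le.1 (hM _ _ hadj)
  have hmod : (t : ℝ) = d * ((t / d : ℤ) : ℝ) + ((t % d : ℤ) : ℝ) := by
    exact_mod_cast (Int.mul_ediv_add_emod t d).symm
  have hm0 : (0 : ℝ) ≤ ((t % d : ℤ) : ℝ) := by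
    exact_mod_cast Int.emod_nonneg t (by exact_mod_cast hd)
  have hm1 : ((t % d : ℤ) : ℝ) + 1 ≤ d := by
    exact_mod_cast Int.emod_lt_of_pos t (by positivity)
  have hkt' : (k : ℝ) ≤ t ∧ (t : ℝ) ≤ k + 1 := by
    rcases ht with rfl | rfl <;> push_cast <;> constructor <;> linarith
  have hd1 : (1 : ℝ) ≤ d := by exact_mod_cast Nat.one_le_iff_ne_zero.2 hd
  have h3 : |β * ((t / d : ℤ) : ℝ) - β / d * k| ≤ β := by
    have : β * ((t / d : ℤ) : ℝ) - β / d * k = β / d * (t - k - ((t % d : ℤ) : ℝ)) := by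
      rw [hmod]; field_simp; ring
    rw [this, abs_mul, abs_of_pos (by positivity : 0 < β / d)]
    calc β / d * |t - k - ((t % d : ℤ) : ℝ)| ≤ β / d * d := by
          refine mul_le_mul_of_nonneg_left (abs_le.2 ⟨?_, ?_⟩) (by positivity) <;> linarith
      _ = β := by field_simp
  have h3 := abs_le.1 h3
  push_cast at h1 h3 hadj h2 ⊢
  rw [abs_le]
  rcases max_cases (h (L i (t / d))) (h (L (e t) m)) with ⟨h4, h5⟩ | ⟨h4, h5⟩ <;> rw [h4] <;>
    constructor <;> linarith

end IsLamination

end Lamination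

/-- Matching the lines: if `T₁`, `T₂` are `n₁`- and `n₂`-regular coarsely oriented
trees laminated by lines of slopes `β₁`, `β₂` with `β₁/β₂ = (n₁−2)/(n₂−2)`, then there
are `K > 0` and an isomorphism of the quotient trees so that corresponding edges,
lifted to `T₁` and `T₂`, differ in height by at most `K`. -/
theorem exists_quotient_iso_bounded_heights {V₁ V₂ ι₁ ι₂ : Type*}
    (G₁ : SimpleGraph V₁) (G₂ : SimpleGraph V₂) (h₁ : V₁ → ℝ) (h₂ : V₂ → ℝ)
    (n₁ n₂ : ℕ) (M β₁ β₂ C₁ C₂ : ℝ)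
    (hT₁ : G₁.IsTree) (hT₂ : G₂.IsTree)
    (hdeg₁ : ∀ v, (G₁.neighborSet v).ncard = n₁) (hn₁ : 3 ≤ n₁)
    (hdeg₂ : ∀ v, (G₂.neighborSet v).ncard = n₂) (hn₂ : 3 ≤ n₂)
    (hM₁ : ∀ u v, G₁.Adj u v → |h₁ u - h₁ v| ≤ M)
    (hM₂ : ∀ u v, G₂.Adj u v → |h₂ u - h₂ v| ≤ M)
    (hβ₁ : 0 < β₁) (hβ₂ : 0 < β₂)
    (L₁ : ι₁ → ℤ → V₁) (L₂ : ι₂ → ℤ → V₂)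
    (hL₁ : IsLamination G₁ h₁ β₁ C₁ L₁) (hL₂ : IsLamination G₂ h₂ β₂ C₂ L₂)
    (hslope : β₁ / β₂ = ((n₁ : ℝ) - 2) / ((n₂ : ℝ) - 2)) :
    ∃ K : ℝ, 0 < K ∧ ∃ f : quotGraph G₁ L₁ ≃g quotGraph G₂ L₂,
      ∀ (i j : ι₁), i ≠ j → ∀ (n m n' m' : ℤ),
        G₁.Adj (L₁ i n) (L₁ j m) → G₂.Adj (L₂ (f i) n') (L₂ (f j) m') →
        |max (h₁ (L₁ i n)) (h₁ (L₁ j m)) - max (h₂ (L₂ (f i) n')) (h₂ (L₂ (f j) m'))| ≤ K := by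
  obtain ⟨d₁, rfl⟩ : ∃ d, n₁ = d + 2 := ⟨n₁ - 2, by omega⟩
  obtain ⟨d₂, rfl⟩ : ∃ d, n₂ = d + 2 := ⟨n₂ - 2, by omega⟩
  have hd₁ : d₁ ≠ 0 := by omega
  have hd₂ : d₂ ≠ 0 := by omega
  have hα : β₂ / d₂ = β₁ / d₁ := by
    push_cast at hslope
    rw [add_sub_cancel_right, add_sub_cancel_right] at hslope
    field_simp at hslope ⊢
    linarith
  have hα0 : 0 < β₁ / d₁ := by positivity
  set α := β₁ / d₁
  set K := (M + C₁ + 2 * β₁) + (M + C₂ + 2 * β₂) + α with hK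
  obtain ⟨f, hf⟩ := (hL₁.quotGraph_isTree hT₁).exists_iso_of_local_equiv
    (hL₂.quotGraph_isTree hT₂)
    (fun i j i' j' => ∀ n m n' m' : ℤ, G₁.Adj (L₁ i n) (L₁ j m) → G₂.Adj (L₂ i' n') (L₂ j' m') →
      |max (h₁ (L₁ i n)) (h₁ (L₁ j m)) - max (h₂ (L₂ i' n')) (h₂ (L₂ j' m'))| ≤ K)
    (fun i i' S hS T hT hS' hT' => by
      obtain ⟨c, e, he⟩ := hL₁.exists_enumeration hT₁.isAcyclic hβ₁ hM₁ hd₁ hdeg₁ i S hS hS'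
      obtain ⟨c', e', he'⟩ := hL₂.exists_enumeration hT₂.isAcyclic hβ₂ hM₂ hd₂ hdeg₂ i' T hT hT'
      refine ⟨e.symm.trans ((Equiv.addRight (round ((c - c') / α))).trans e'),
        fun x n m n' m' hx hy => ?_⟩
      obtain ⟨k, rfl⟩ := e.surjective x
      simp only [Equiv.trans_apply, Equiv.symm_apply_apply, Equiv.coe_addRight] at hy ⊢
      have h1 := abs_le.1 (he k n m hx)
      have h2 := abs_le.1 (he' _ n' m' hy)
      have h3 := abs_le.1 (abs_sub_round ((c - c') / α))
      have h4 : (c - c') = α * ((c - c') / α) := by field_simp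
      rw [hα] at h2
      push_cast at h2
      have h5 := mul_le_mul_of_nonneg_left h3.1 hα0.le
      have h6 := mul_le_mul_of_nonneg_left h3.2 hα0.le
      rw [mul_sub, ← h4] at h5 h6
      rw [abs_le]
      constructor <;> linarith)
  refine ⟨max K 1, by positivity, f, fun i j hij n m n' m' h h' => le_max_of_le_left ?_⟩
  rcases hf i j (quotGraph_adj.2 ⟨hij, n, m, h⟩) with hR | hR
  · exact hR n m n' m' h h'
  · have := hR m n m' n' h.symm h'.symm
    rwa [max_comm, max_comm (h₂ _)] at this
end

section
/- Let a, b, c, d be integers with 1 < a < b, 1 < c < d, gcd(a,b) = 1, gcd(c,d) = 1, and (a,b) ≠ (c,d). Then the Baumslag–Solitar groups BS(a,b) and BS(c,d) are not abstractly commensurable. -/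
/-- The single relator `x y^m x⁻¹ y⁻ⁿ` of the Baumslag–Solitar group. -/
def BSRels (m n : ℤ) : Set (FreeGroup (Fin 2)) :=
  {FreeGroup.of 0 * FreeGroup.of 1 ^ m * (FreeGroup.of 0)⁻¹ * (FreeGroup.of 1 ^ n)⁻¹}

/-- The Baumslag–Solitar group `BS(m,n) = ⟨x, y | x y^m x⁻¹ = y^n⟩`. -/
abbrev BS (m n : ℤ) : Type := PresentedGroup (BSRels m n)

/-- Two groups are abstractly commensurable if they have isomorphic finite-index
subgroups. -/
def AbstractlyCommensurable (G H : Type*) [Group G] [Group H] : Prop :=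
  ∃ (G₁ : Subgroup G) (H₁ : Subgroup H),
    G₁.index ≠ 0 ∧ H₁.index ≠ 0 ∧ Nonempty (G₁ ≃* H₁)

namespace BaumslagSolitar

open HNNExtension

variable {a b : ℤ}

/-- The stable letter of `BS a b`. -/
def x (a b : ℤ) : BS a b := PresentedGroup.of 0

/-- The base generator of `BS a b`. -/
def y (a b : ℤ) : BS a b := PresentedGroup.of 1

/-- The power of the base generator that is moved across `x ^ e` from right to left. -/
def per (a b : ℤ) (e : ℤˣ) : ℤ := if e = 1 then a else b

@[simp] lemma per_one : per a b 1 = a := rfl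

@[simp] lemma per_neg_one : per a b (-1) = b := rfl

lemma x_mul_y_zpow : x a b * y a b ^ a = y a b ^ b * x a b := by
  have h : PresentedGroup.mk (BSRels a b) _ = 1 :=
    PresentedGroup.one_of_mem (rels := BSRels a b) rfl
  have h' : x a b * y a b ^ a * (x a b)⁻¹ * (y a b ^ b)⁻¹ = 1 := by
    simp only [map_mul, map_inv, map_zpow] at h
    exact h
  rw [mul_inv_eq_one, mul_inv_eq_iff_eq_mul] at h'
  exact h'

lemma y_zpow_mul_x_zpow (e : ℤˣ) (k : ℤ) :
    y a b ^ (per a b (-e) * k) * x a b ^ (e : ℤ) = x a b ^ (e : ℤ) * y a b ^ (per a b e * k) := by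
  have h : SemiconjBy (x a b) (y a b ^ (a * k)) (y a b ^ (b * k)) := by
    rw [zpow_mul, zpow_mul]
    exact SemiconjBy.zpow_right x_mul_y_zpow k
  rcases Int.units_eq_one_or e with rfl | rfl
  · simpa using h.eq.symm
  · simpa using h.inv_symm_left.eq.symm

lemma closure_x_y : Subgroup.closure {x a b, y a b} = ⊤ := by
  rw [← PresentedGroup.closure_range_of (BSRels a b)]
  congr 1
  ext g
  simp [x, y, eq_comm]

/-- The product of the letters `x ^ e * y ^ k`. -/
def word (a b : ℤ) (l : List (ℤˣ × ℤ)) : BS a b :=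
  (l.map fun p => x a b ^ (p.1 : ℤ) * y a b ^ p.2).prod

@[simp] lemma word_nil : word a b [] = 1 := rfl

@[simp] lemma word_cons (p : ℤˣ × ℤ) (l : List (ℤˣ × ℤ)) :
    word a b (p :: l) = x a b ^ (p.1 : ℤ) * y a b ^ p.2 * word a b l := by
  simp [word]

@[simp] lemma word_append (l l' : List (ℤˣ × ℤ)) :
    word a b (l ++ l') = word a b l * word a b l' := by
  simp [word]

/-- A list of letters without a pinch. -/
def Reduced (a b : ℤ) (l : List (ℤˣ × ℤ)) : Prop :=
  l.IsChain fun p q => per a b p.1 ∣ p.2 → p.1 = q.1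

section Britton

/-- The subgroup generated by `k` in the infinite cyclic group. -/
abbrev mulSubgroup (k : ℤ) : Subgroup (Multiplicative ℤ) :=
  (zpowersHom (Multiplicative ℤ) (Multiplicative.ofAdd k)).range

lemma mem_mulSubgroup {k : ℤ} {z : Multiplicative ℤ} :
    z ∈ mulSubgroup k ↔ k ∣ z.toAdd := by
  constructor
  · rintro ⟨n, rfl⟩
    exact ⟨n.toAdd, by simp [mul_comm]⟩
  · rintro ⟨n, hn⟩
    refine ⟨Multiplicative.ofAdd n, Multiplicative.toAdd.injective ?_⟩
    simp [hn, mul_comm]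

lemma zpowersHom_injective {k : ℤ} (hk : k ≠ 0) :
    Function.Injective (zpowersHom (Multiplicative ℤ) (Multiplicative.ofAdd k)) := by
  intro m n h
  have := congrArg Multiplicative.toAdd h
  simpa [hk] using this

/-- The isomorphism between the subgroups generated by `a` and `b` sending `a` to `b`. -/
noncomputable def mulEquivSubgroup (ha : a ≠ 0) (hb : b ≠ 0) :
    mulSubgroup a ≃* mulSubgroup b :=
  (MonoidHom.ofInjective (zpowersHom_injective ha)).symm.trans
    (MonoidHom.ofInjective (zpowersHom_injective hb))

/-- The map from `BS a b` to the corresponding HNN extension. -/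
noncomputable def toHNN (ha : a ≠ 0) (hb : b ≠ 0) :
    BS a b →* HNNExtension (Multiplicative ℤ) _ _ (mulEquivSubgroup ha hb) :=
  PresentedGroup.toGroup (f := ![t, of (Multiplicative.ofAdd 1)]) (by
    rintro _ rfl
    have h := t_mul_of (φ := mulEquivSubgroup ha hb)
      (MonoidHom.ofInjective (zpowersHom_injective ha) (Multiplicative.ofAdd 1))
    simp only [mulEquivSubgroup, MulEquiv.trans_apply, MulEquiv.symm_apply_apply] at h
    simp only [MonoidHom.ofInjective_apply, zpowersHom_apply, toAdd_ofAdd, zpow_one] at h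
    simp only [map_mul, map_inv, map_zpow, FreeGroup.lift_apply_of, Matrix.cons_val_zero,
      Matrix.cons_val_one]
    rw [← map_zpow (of (φ := mulEquivSubgroup ha hb)), ← map_zpow (of (φ := mulEquivSubgroup ha hb)),
      ← ofAdd_zsmul, ← ofAdd_zsmul, smul_eq_mul, smul_eq_mul, mul_one, mul_one,
      mul_inv_eq_one, mul_inv_eq_iff_eq_mul]
    exact h)

lemma toHNN_x (ha : a ≠ 0) (hb : b ≠ 0) : toHNN ha hb (x a b) = t := by
  simp [toHNN, x]

lemma toHNN_y_zpow (ha : a ≠ 0) (hb : b ≠ 0) (k : ℤ) :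
    toHNN ha hb (y a b ^ k) = of (Multiplicative.ofAdd k) := by
  rw [map_zpow, toHNN, y, PresentedGroup.toGroup.of]
  simp [← map_zpow, ← ofAdd_zsmul]

lemma mem_toSubgroup {e : ℤˣ} {z : Multiplicative ℤ} :
    z ∈ toSubgroup (mulSubgroup a) (mulSubgroup b) e ↔ per a b e ∣ z.toAdd := by
  rcases Int.units_eq_one_or e with rfl | rfl <;> simp only [toSubgroup_one, toSubgroup_neg_one,
    mem_mulSubgroup, per_one, per_neg_one]

/-- The reduced word of the HNN extension attached to a reduced list. -/
def Reduced.toReducedWord {l : List (ℤˣ × ℤ)} (hl : Reduced a b l) (k : ℤ) :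
    NormalWord.ReducedWord (Multiplicative ℤ) (mulSubgroup a) (mulSubgroup b) where
  head := Multiplicative.ofAdd k
  toList := l.map fun p => (p.1, Multiplicative.ofAdd p.2)
  chain := by
    rw [List.isChain_map]
    refine List.IsChain.imp (fun p q h h' => h ?_) hl
    simpa [mem_toSubgroup] using h'

lemma prod_toReducedWord (ha : a ≠ 0) (hb : b ≠ 0) {l : List (ℤˣ × ℤ)} (hl : Reduced a b l)
    (k : ℤ) : (hl.toReducedWord k).prod (mulEquivSubgroup ha hb) =
      toHNN ha hb (y a b ^ k * word a b l) := by
  rw [map_mul, toHNN_y_zpow, NormalWord.ReducedWord.prod, word, map_list_prod]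
  simp only [Reduced.toReducedWord, List.map_map]
  congr 3
  funext p
  simp [toHNN_x, toHNN_y_zpow, -map_zpow, map_zpow _ (x a b)]

lemma Reduced.of_mul_word_eq (ha : a ≠ 0) (hb : b ≠ 0) {l l' : List (ℤˣ × ℤ)}
    (hl : Reduced a b l) (hl' : Reduced a b l') {k m : ℤ}
    (h : y a b ^ k * word a b l = y a b ^ m * word a b l') :
    l.map Prod.fst = l'.map Prod.fst ∧ ∀ p ∈ l.head?, per a b (-p.1) ∣ m - k := by
  have h' : (hl.toReducedWord k).prod (mulEquivSubgroup ha hb) =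
      (hl'.toReducedWord m).prod (mulEquivSubgroup ha hb) := by
    rw [prod_toReducedWord, prod_toReducedWord, h]
  obtain ⟨h₁, h₂⟩ := ReducedWord.map_fst_eq_and_of_prod_eq _ h'
  refine ⟨by simpa [Reduced.toReducedWord, Function.comp_def] using h₁, fun p hp => ?_⟩
  have := h₂ p.1 (by
    rw [Option.mem_def] at hp
    simp [Reduced.toReducedWord, hp])
  rw [mem_toSubgroup] at this
  simpa [Reduced.toReducedWord, sub_eq_neg_add] using this

end Britton

lemma y_zpow_injective (ha : a ≠ 0) (hb : b ≠ 0) {k : ℤ} (h : y a b ^ k = 1) : k = 0 := by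
  have h' := congrArg (toHNN ha hb) h
  rw [toHNN_y_zpow, map_one] at h'
  have := of_injective _ (h'.trans (map_one _).symm)
  simpa using this

lemma Reduced.exists_word_mul {l : List (ℤˣ × ℤ)} (hl : Reduced a b l) (hne : l ≠ []) (r : ℤ) :
    ∃ l', Reduced a b l' ∧ l'.length = l.length ∧ word a b l' = word a b l * y a b ^ r := by
  obtain ⟨l, p, rfl⟩ := l.eq_nil_or_concat'.resolve_left hne
  refine ⟨l ++ [(p.1, p.2 + r)], ?_, by simp, ?_⟩
  · rw [Reduced, List.isChain_append] at hl ⊢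
    simpa using hl
  · simp [mul_assoc, zpow_add]

lemma Reduced.dvd_of_mul_word_eq (ha : a ≠ 0) (hb : b ≠ 0) {e : ℤˣ} {l l' : List (ℤˣ × ℤ)}
    (hl : Reduced a b l) (he : l.head?.map Prod.fst = some e) (hl' : Reduced a b l')
    (hne : l' ≠ []) {k r : ℤ} (h : y a b ^ k * word a b l = word a b l' * y a b ^ r) :
    per a b (-e) ∣ k := by
  obtain ⟨l'', h₁, -, h₂⟩ := hl'.exists_word_mul hne r
  obtain ⟨p, hp, rfl⟩ := Option.map_eq_some_iff.1 he
  have := (hl.of_mul_word_eq ha hb h₁ (k := k) (m := 0) (by rw [h, h₂]; simp)).2 p hp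
  simpa using this

lemma exists_reduced (g : BS a b) :
    ∃ (k : ℤ) (l : _), Reduced a b l ∧ g = y a b ^ k * word a b l := by
  have hx : ∀ (e : ℤˣ) (g : BS a b), (∃ (k : ℤ) (l : _), Reduced a b l ∧ g = y a b ^ k * word a b l) →
      ∃ (k : ℤ) (l : _), Reduced a b l ∧ x a b ^ (e : ℤ) * g = y a b ^ k * word a b l := by
    rintro e _ ⟨k, l, hl, rfl⟩
    by_cases h : Reduced a b ((e, k) :: l)
    · exact ⟨0, _, h, by simp [mul_assoc]⟩
    · obtain _ | ⟨⟨e', k'⟩, l⟩ := l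
      · exact absurd (List.isChain_singleton _) h
      · simp only [Reduced, List.isChain_cons_cons, not_and] at h hl
        have h' : ¬ (per a b e ∣ k → e = e') := fun h' => h h' hl
        rw [Classical.not_imp] at h'
        obtain ⟨⟨k, rfl⟩, hne⟩ := h'
        obtain rfl : e' = -e := by
          rcases Int.units_eq_one_or e with rfl | rfl <;>
          rcases Int.units_eq_one_or e' with rfl | rfl <;> simp at hne ⊢
        refine ⟨per a b (-e) * k + k', l, hl.tail, ?_⟩
        rw [← mul_assoc, ← y_zpow_mul_x_zpow]
        simp [zpow_add, mul_assoc]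
  have hg : g ∈ Subgroup.closure {x a b, y a b} := by simp [closure_x_y]
  induction hg using Subgroup.closure_induction_left with
  | one => exact ⟨0, [], List.isChain_nil, by simp⟩
  | mul_left z hz g _ ih =>
    rcases hz with rfl | rfl
    · simpa using hx 1 g ih
    · obtain ⟨k, l, hl, rfl⟩ := ih
      exact ⟨1 + k, l, hl, by simp [zpow_add, mul_assoc]⟩
  | inv_mul_cancel z hz g _ ih =>
    rcases hz with rfl | rfl
    · simpa using hx (-1) g ih
    · obtain ⟨k, l, hl, rfl⟩ := ih
      exact ⟨-1 + k, l, hl, by simp [zpow_add, mul_assoc]⟩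

lemma pow_mul_pow_dvd_mul_iff (hab : IsCoprime a b) (ha : a ≠ 0) (i j : ℕ) (k : ℤ) :
    a ^ i * b ^ j ∣ a * k ↔ a ^ (i - 1) * b ^ j ∣ k := by
  cases i with
  | zero =>
    simp only [pow_zero, one_mul, Nat.zero_sub]
    exact ⟨hab.symm.pow_left.dvd_of_dvd_mul_left, fun h => h.mul_left a⟩
  | succ i => rw [pow_succ', mul_assoc, mul_dvd_mul_iff_left ha, Nat.add_sub_cancel]

lemma y_zpow_mul_word_cons_iff (ha : a ≠ 0) (hb : b ≠ 0) {e : ℤˣ} {r : ℤ} {l : List (ℤˣ × ℤ)}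
    (hl : Reduced a b ((e, r) :: l)) (k m : ℤ) :
    y a b ^ k * word a b ((e, r) :: l) = word a b ((e, r) :: l) * y a b ^ m ↔
      ∃ k', k = per a b (-e) * k' ∧ y a b ^ (per a b e * k') * word a b l =
        word a b l * y a b ^ m := by
  have key (k' : ℤ) : y a b ^ (per a b (-e) * k') * word a b ((e, r) :: l) =
      word a b ((e, r) :: l) * y a b ^ m ↔ y a b ^ (per a b e * k') * word a b l =
        word a b l * y a b ^ m := by
    rw [word_cons, ← mul_assoc, ← mul_assoc, y_zpow_mul_x_zpow, mul_assoc (x a b ^ _), ← zpow_add,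
      add_comm, zpow_add]
    simp only [mul_assoc, mul_right_inj]
  constructor
  · intro h
    obtain ⟨k', rfl⟩ := hl.dvd_of_mul_word_eq ha hb (e := e) (by simp) hl (by simp) h
    exact ⟨k', rfl, (key k').1 h⟩
  · rintro ⟨k', rfl, h⟩
    exact (key k').2 h

lemma Reduced.exists_y_zpow_mul_word_iff (hab : IsCoprime a b) (ha : 0 < a) (hb : 0 < b)
    {l : List (ℤˣ × ℤ)} (hl : Reduced a b l) :
    ∃ (i j : ℕ) (P Q : ℤ), 0 < P ∧ 0 < Q ∧ ∀ k m : ℤ,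
      y a b ^ k * word a b l = word a b l * y a b ^ m ↔ a ^ i * b ^ j ∣ k ∧ k * P = m * Q := by
  induction l with
  | nil =>
    refine ⟨0, 0, 1, 1, one_pos, one_pos, fun k m => ?_⟩
    simp only [word_nil, mul_one, one_mul, pow_zero, one_dvd, true_and]
    refine ⟨fun h => ?_, fun h => by rw [h]⟩
    rw [← mul_inv_eq_one, ← zpow_neg, ← zpow_add] at h
    linarith [y_zpow_injective ha.ne' hb.ne' h]
  | cons p l ih =>
    obtain ⟨e, r⟩ := p
    obtain ⟨i, j, P, Q, hP, hQ, h⟩ := ih hl.tail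
    simp only [y_zpow_mul_word_cons_iff ha.ne' hb.ne' hl, h]
    rcases Int.units_eq_one_or e with rfl | rfl
    · refine ⟨i - 1, j + 1, a * P, b * Q, by positivity, by positivity, fun k m => ?_⟩
      simp only [per_one, per_neg_one, pow_mul_pow_dvd_mul_iff hab ha.ne']
      constructor
      · rintro ⟨k', rfl, h₁, h₂⟩
        refine ⟨?_, by linear_combination b * h₂⟩
        rw [pow_succ', mul_left_comm]
        exact mul_dvd_mul_left b h₁
      · rintro ⟨h₁, h₂⟩
        rw [pow_succ', mul_left_comm] at h₁
        obtain ⟨k', rfl⟩ := dvd_of_mul_right_dvd h₁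
        refine ⟨k', rfl, (mul_dvd_mul_iff_left hb.ne').1 h₁, mul_left_cancel₀ hb.ne' ?_⟩
        linear_combination h₂
    · refine ⟨i + 1, j - 1, b * P, a * Q, by positivity, by positivity, fun k m => ?_⟩
      simp only [per_one, per_neg_one, neg_neg, mul_comm (a ^ i),
        pow_mul_pow_dvd_mul_iff hab.symm hb.ne']
      constructor
      · rintro ⟨k', rfl, h₁, h₂⟩
        refine ⟨?_, by linear_combination a * h₂⟩
        rw [pow_succ', mul_assoc, mul_comm (a ^ i)]
        exact mul_dvd_mul_left a h₁
      · rintro ⟨h₁, h₂⟩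
        rw [pow_succ', mul_assoc, mul_comm (a ^ i)] at h₁
        obtain ⟨k', rfl⟩ := dvd_of_mul_right_dvd h₁
        refine ⟨k', rfl, (mul_dvd_mul_iff_left ha.ne').1 h₁, mul_left_cancel₀ ha.ne' ?_⟩
        linear_combination h₂

lemma exists_y_zpow_mul_iff (hab : IsCoprime a b) (ha : 0 < a) (hb : 0 < b) (g : BS a b) :
    ∃ (i j : ℕ) (P Q : ℤ), 0 < P ∧ 0 < Q ∧ ∀ k m : ℤ,
      y a b ^ k * g = g * y a b ^ m ↔ a ^ i * b ^ j ∣ k ∧ k * P = m * Q := by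
  obtain ⟨k₀, l, hl, rfl⟩ := exists_reduced g
  obtain ⟨i, j, P, Q, hP, hQ, h⟩ := hl.exists_y_zpow_mul_word_iff hab ha hb
  refine ⟨i, j, P, Q, hP, hQ, fun k m => ?_⟩
  rw [← h, ← mul_assoc, ← zpow_add, add_comm, zpow_add]
  simp only [mul_assoc, mul_right_inj]

lemma exists_commute_iff (hab : IsCoprime a b) (ha : 0 < a) (hb : 0 < b) {g : BS a b} {k : ℤ}
    (hk : k ≠ 0) (h : Commute g (y a b ^ k)) :
    ∃ i j : ℕ, ∀ m : ℤ, Commute g (y a b ^ m) ↔ a ^ i * b ^ j ∣ m := by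
  obtain ⟨i, j, P, Q, hP, hQ, hg⟩ := exists_y_zpow_mul_iff hab ha hb g
  obtain rfl : P = Q := mul_left_cancel₀ hk ((hg k k).1 h.symm.eq).2
  exact ⟨i, j, fun m => ⟨fun h => ((hg m m).1 h.symm.eq).1, fun h => ((hg m m).2 ⟨h, rfl⟩).symm⟩⟩

lemma exists_pos_y_zpow_mul (hab : IsCoprime a b) (ha : 0 < a) (hb : 0 < b) (g : BS a b) :
    ∃ k m : ℕ, 0 < k ∧ 0 < m ∧ y a b ^ k * g = g * y a b ^ m := by
  obtain ⟨i, j, P, Q, hP, hQ, h⟩ := exists_y_zpow_mul_iff hab ha hb g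
  have := (h (a ^ i * b ^ j * Q) (a ^ i * b ^ j * P)).2 ⟨dvd_mul_right _ _, by ring⟩
  have h₁ : 0 < a ^ i * b ^ j * Q := by positivity
  have h₂ : 0 < a ^ i * b ^ j * P := by positivity
  lift a ^ i * b ^ j * Q to ℕ using h₁.le with k
  lift a ^ i * b ^ j * P to ℕ using h₂.le with m
  exact ⟨k, m, by exact_mod_cast h₁, by exact_mod_cast h₂, by exact_mod_cast this⟩

/-- The conjugate of `y ^ M` by `x ^ (-e * n)`. -/
def conjY (a b : ℤ) (M : ℤ) (e : ℤˣ) (n : ℕ) : BS a b :=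
  ((x a b ^ (e : ℤ)) ^ n)⁻¹ * y a b ^ M * (x a b ^ (e : ℤ)) ^ n

lemma conjY_succ (M : ℤ) (e : ℤˣ) (n : ℕ) :
    conjY a b M e (n + 1) = (x a b ^ (e : ℤ))⁻¹ * conjY a b M e n * x a b ^ (e : ℤ) := by
  simp [conjY, pow_succ, mul_assoc]

lemma exists_reduced_conjY {M : ℤ} {e : ℤˣ} (hM : ¬ per a b (-e) ∣ M) (n : ℕ) :
    ∃ l, Reduced a b l ∧ l.head?.map Prod.fst = some (-e) ∧ word a b l = conjY a b M e (n + 1) := by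
  refine ⟨List.replicate n (-e, 0) ++ (-e, M) :: List.replicate (n + 1) (e, 0), ?_, ?_, ?_⟩
  · refine (List.isChain_replicate_of_rel n fun _ => rfl).append (List.isChain_cons.2 ⟨?_,
      List.isChain_replicate_of_rel _ fun _ => rfl⟩) ?_
    · simp [List.head?_replicate, hM]
    · simp [List.getLast?_replicate]
  · cases n <;> simp [List.replicate_succ]
  · simp only [word_append, word_cons, Units.val_neg, conjY]
    simp only [word, List.map_replicate, List.prod_replicate, zpow_zero, mul_one, Units.val_neg,
      zpow_neg, pow_succ', mul_inv_rev, inv_pow, mul_assoc]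

lemma commute_conjY_iff (hab : IsCoprime a b) (ha : a ≠ 0) (hb : b ≠ 0) {M : ℤ} {e : ℤˣ}
    (hM : ¬ per a b (-e) ∣ M) (n : ℕ) (m : ℤ) :
    Commute (conjY a b M e n) (y a b ^ m) ↔ per a b e ^ n ∣ m := by
  have hcop : IsCoprime (per a b e) (per a b (-e)) := by
    rcases Int.units_eq_one_or e with rfl | rfl
    exacts [hab, hab.symm]
  have hne : per a b e ≠ 0 := by
    rcases Int.units_eq_one_or e with rfl | rfl
    exacts [ha, hb]
  induction n generalizing m with
  | zero => simp [conjY]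
  | succ n ih =>
    have key (m : ℤ) : Commute (conjY a b M e (n + 1)) (y a b ^ (per a b e * m)) ↔
        per a b e ^ n ∣ m := by
      have h := y_zpow_mul_x_zpow (a := a) (b := b) e m
      rw [← inv_mul_eq_iff_eq_mul, ← mul_assoc] at h
      have hc := Commute.conj_iff (a := conjY a b M e n) (b := y a b ^ (per a b (-e) * m))
        (x a b ^ (e : ℤ))⁻¹
      rw [inv_inv, h, ← conjY_succ] at hc
      exact hc.trans ((ih _).trans
        ⟨hcop.pow_left.dvd_of_dvd_mul_left, fun h => h.mul_left _⟩)
    constructor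
    · intro h
      obtain ⟨l, hl, hhead, hw⟩ := exists_reduced_conjY hM n
      obtain ⟨m, rfl⟩ := hl.dvd_of_mul_word_eq ha hb hhead hl (by rintro rfl; simp at hhead)
        (k := m) (r := m) (by rw [hw]; exact h.symm.eq)
      rw [neg_neg] at h ⊢
      rw [pow_succ']
      exact mul_dvd_mul_left _ ((key m).1 h)
    · rintro ⟨m, rfl⟩
      rw [pow_succ', mul_assoc, key]
      exact dvd_mul_right _ _

lemma conjY_mem {K : Subgroup (BS a b)} [K.Normal] {M : ℤ} (hM : y a b ^ M ∈ K) (e : ℤˣ) (n : ℕ) :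
    conjY a b M e n ∈ K := by
  simpa [conjY] using ‹K.Normal›.conj_mem _ hM ((x a b ^ (e : ℤ)) ^ n)⁻¹

lemma exists_y_pow_mem_normalCore (hab : IsCoprime a b) (ha : 0 < a) (hb : 0 < b)
    (K : Subgroup (BS a b)) (hK : K.index ≠ 0) :
    ∃ M : ℕ, 0 < M ∧ IsCoprime (M : ℤ) a ∧ IsCoprime (M : ℤ) b ∧ y a b ^ M ∈ K.normalCore := by
  have : K.FiniteIndex := ⟨hK⟩
  set z : BS a b ⧸ K.normalCore := QuotientGroup.mk' _ (y a b) with hz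
  refine ⟨orderOf z, orderOf_pos z, ?_⟩
  have hconj : orderOf (z ^ a) = orderOf (z ^ b) := by
    have h := congrArg (QuotientGroup.mk' K.normalCore) (x_mul_y_zpow (a := a) (b := b))
    simp only [map_mul, map_zpow, ← hz] at h
    exact SemiconjBy.orderOf_eq _ h
  lift a to ℕ using ha.le
  lift b to ℕ using hb.le
  rw [zpow_natCast, zpow_natCast, orderOf_pow, orderOf_pow] at hconj
  have hgcd : (orderOf z).gcd a = (orderOf z).gcd b := by
    have h₁ := Nat.mul_div_cancel' ((orderOf z).gcd_dvd_left a)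
    have h₂ := Nat.mul_div_cancel' ((orderOf z).gcd_dvd_left b)
    rw [← hconj] at h₂
    refine Nat.eq_of_mul_eq_mul_right (Nat.pos_of_ne_zero fun h => ?_) (h₁.trans h₂.symm)
    rw [h, mul_zero] at h₁
    exact (orderOf_pos z).ne h₁
  have hone : (orderOf z).gcd a = 1 := by
    refine Nat.eq_one_of_dvd_coprimes (Nat.isCoprime_iff_coprime.1 hab) (Nat.gcd_dvd_right _ _) ?_
    exact hgcd ▸ Nat.gcd_dvd_right _ _
  refine ⟨Nat.isCoprime_iff_coprime.2 hone, Nat.isCoprime_iff_coprime.2 (hgcd.symm.trans hone), ?_⟩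
  rw [← QuotientGroup.eq_one_iff]
  exact pow_orderOf_eq_one z

lemma Reduced.exists_conj (n : ℕ) (k : ℤ) (l : List (ℤˣ × ℤ)) (hn : l.length = n)
    (hl : Reduced a b l) :
    ∃ h, (∃ s : ℤ, y a b ^ k * word a b l = h * y a b ^ s * h⁻¹) ∨
      ∃ l', l' ≠ [] ∧ Reduced a b (l' ++ l') ∧
        y a b ^ k * word a b l = h * word a b l' * h⁻¹ := by
  induction n using Nat.strong_induction_on generalizing k l with
  | _ n ih =>
  by_cases hne : l = []
  · exact ⟨1, .inl ⟨k, by simp [hne]⟩⟩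
  obtain ⟨L, hL, hlen, hw⟩ := hl.exists_word_mul hne k
  have hw' : y a b ^ k * word a b l = y a b ^ k * word a b L * (y a b ^ k)⁻¹ := by
    rw [hw]; group
  by_cases hLL : Reduced a b (L ++ L)
  · refine ⟨y a b ^ k, .inr ⟨L, ?_, hLL, hw'⟩⟩
    rintro rfl
    exact hne (List.length_eq_zero_iff.1 hlen.symm)
  rw [Reduced, List.isChain_append] at hLL
  simp only [not_and, not_forall] at hLL
  obtain ⟨q, hq, p, hp, ⟨k', hk'⟩, hpq⟩ := hLL hL hL
  obtain _ | ⟨p, L⟩ := L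
  · simp at hp
  obtain rfl | ⟨L, q, rfl⟩ := L.eq_nil_or_concat'
  · simp_all
  simp only [List.head?_cons, Option.mem_def, Option.some.injEq] at hp
  simp only [← List.cons_append, List.getLast?_append, List.getLast?_singleton, Option.some_or,
    Option.mem_def, Option.some.injEq] at hq
  subst hp hq
  obtain ⟨e, r⟩ := p
  obtain ⟨f, s⟩ := q
  obtain rfl : e = -f := by
    rcases Int.units_eq_one_or e with rfl | rfl <;>
    rcases Int.units_eq_one_or f with rfl | rfl <;> simp at hpq ⊢
  simp only at hk'
  subst hk'
  have hlt : L.length < n := by simp at hlen; omega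
  have hred : Reduced a b L := hL.tail.left_of_append
  have hconj : word a b ((-f, r) :: (L ++ [(f, per a b f * k')])) = (x a b ^ (f : ℤ))⁻¹ *
      y a b ^ (-(per a b (-f) * k')) *
      (y a b ^ (per a b (-f) * k' + r) * word a b L) *
      ((x a b ^ (f : ℤ))⁻¹ * y a b ^ (-(per a b (-f) * k')))⁻¹ := by
    simp only [word_cons, word_append, word_nil, mul_one, ← y_zpow_mul_x_zpow]
    simp only [Units.val_neg]
    group
  obtain ⟨h, hh⟩ := ih _ hlt (per a b (-f) * k' + r) L rfl hred
  refine ⟨y a b ^ k * ((x a b ^ (f : ℤ))⁻¹ * y a b ^ (-(per a b (-f) * k'))) * h, ?_⟩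
  rw [hw', hconj]
  refine hh.imp ?_ ?_
  · rintro ⟨s, hs⟩
    exact ⟨s, by rw [hs]; simp only [mul_inv_rev, mul_assoc]⟩
  · rintro ⟨l', hl', hr, hs⟩
    exact ⟨l', hl', hr, by rw [hs]; simp only [mul_inv_rev, mul_assoc]⟩

lemma word_flatten_replicate (l : List (ℤˣ × ℤ)) (p : ℕ) :
    word a b (List.replicate p l).flatten = word a b l ^ p := by
  induction p with
  | zero => simp
  | succ p ih => simp [List.replicate_succ, ih, pow_succ']

lemma Reduced.flatten_replicate {l : List (ℤˣ × ℤ)} (hne : l ≠ []) (hl : Reduced a b (l ++ l))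
    (p : ℕ) : Reduced a b (List.replicate p l).flatten := by
  induction p with
  | zero => exact List.isChain_nil
  | succ p ih =>
    cases p with
    | zero =>
      rw [List.replicate_one, List.flatten_singleton]
      exact hl.left_of_append
    | succ p =>
      rw [List.replicate_succ, List.flatten_cons] at ih ⊢
      rw [List.replicate_succ, List.flatten_cons, ← List.append_assoc]
      exact List.IsChain.append_overlap hl ih hne

lemma y_zpow_mul_word_pow_ne (ha : a ≠ 0) (hb : b ≠ 0) {M : ℤ} (hMa : ¬ a ∣ M) (hMb : ¬ b ∣ M)
    {l : List (ℤˣ × ℤ)} (hne : l ≠ []) (hl : Reduced a b (l ++ l)) {p q : ℕ} (hp : 0 < p)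
    (hq : 0 < q) : y a b ^ M * word a b l ^ p ≠ word a b l ^ q * y a b ^ M := by
  intro h
  rw [← word_flatten_replicate, ← word_flatten_replicate] at h
  obtain ⟨⟨e, r⟩, l', rfl⟩ := List.exists_cons_of_ne_nil hne
  have hdvd := (Reduced.flatten_replicate hne hl p).dvd_of_mul_word_eq ha hb (e := e) (by
    obtain ⟨p, rfl⟩ := Nat.exists_eq_add_of_lt hp
    simp [List.replicate_succ]) (Reduced.flatten_replicate hne hl q) (by
    obtain ⟨q, rfl⟩ := Nat.exists_eq_add_of_lt hq
    simp [List.replicate_succ]) h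
  rcases Int.units_eq_one_or e with rfl | rfl
  exacts [hMb hdvd, hMa hdvd]

lemma exists_pow_eq_y_zpow (hab : IsCoprime a b) (ha : 1 < a) (hb : 1 < b)
    {K : Subgroup (BS a b)} (hK : K.index ≠ 0) {v : BS a b}
    (hv : ∀ g ∈ K, ∃ p q : ℕ, 0 < p ∧ 0 < q ∧ g * v ^ p = v ^ q * g) :
    ∃ (k : ℕ) (m : ℤ), 0 < k ∧ v ^ k = y a b ^ m := by
  obtain ⟨k, l, hl, rfl⟩ := exists_reduced v
  obtain ⟨h, ⟨s, hs⟩ | ⟨l', hne, hl', hs⟩⟩ := hl.exists_conj _ k l rfl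
  · rw [hs]
    obtain ⟨k, m, hk, -, h'⟩ := exists_pos_y_zpow_mul hab (by lia) (by lia) h⁻¹
    refine ⟨k, m * s, hk, ?_⟩
    rw [eq_inv_mul_iff_mul_eq, ← mul_assoc] at h'
    rw [conj_pow, zpow_mul, zpow_natCast, ← h', conj_zpow, ← zpow_natCast, ← zpow_natCast,
      ← zpow_mul, ← zpow_mul, mul_comm]
  · rw [hs] at hv
    obtain ⟨M, -, hMa, hMb, hM⟩ := exists_y_pow_mem_normalCore hab (by lia) (by lia) K hK
    obtain ⟨p, q, hp, hq, hpq⟩ := hv (h * y a b ^ M * h⁻¹)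
      (K.normalCore_le (K.normalCore_normal.conj_mem _ hM h))
    have not_dvd {c : ℤ} (hc : 1 < c) (h : IsCoprime (M : ℤ) c) : ¬ c ∣ M := fun h' => by
      have := Int.isUnit_iff.1 (h.isUnit_of_dvd' h' dvd_rfl)
      lia
    refine absurd ?_ (y_zpow_mul_word_pow_ne (by lia) (by lia) (not_dvd ha hMa) (not_dvd hb hMb)
      hne hl' hp hq)
    rw [conj_pow, conj_pow] at hpq
    refine mul_left_cancel (a := h) (mul_right_cancel (b := h⁻¹) ?_)
    simpa only [mul_assoc, inv_mul_cancel_left, zpow_natCast] using hpq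

variable {c d : ℤ}

lemma commute_coe_iff {G : Type*} [Group G] {K : Subgroup G} (g v : K) :
    Commute (g : G) v ↔ Commute g v := by
  rw [commute_iff_eq, commute_iff_eq, ← Subtype.coe_inj, Subgroup.coe_mul, Subgroup.coe_mul]

lemma exists_dvd_iff_dvd (hab : IsCoprime a b) (ha : 1 < a) (hb : 1 < b)
    (hcd : IsCoprime c d) (hc : 1 < c) (hd : 1 < d)
    {K : Subgroup (BS a b)} {L : Subgroup (BS c d)} (φ : K ≃* L) {M N : ℕ} (hN₀ : 0 < N)
    (hMa : IsCoprime (M : ℤ) a) (hMb : IsCoprime (M : ℤ) b) (hM : y a b ^ M ∈ K.normalCore)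
    (hNc : IsCoprime (N : ℤ) c) (hNd : IsCoprime (N : ℤ) d) {v : K} {w : L}
    (hv : (v : BS a b) = y a b ^ M) (hw : (w : BS c d) = y c d ^ N) {p q : ℤ}
    (hp : p ≠ 0) (h : φ (v ^ q) = w ^ p) (e : ℤˣ) (i : ℕ) :
    ∃ s t : ℕ, ∀ k : ℤ, per a b e ^ i ∣ q * k ↔ c ^ s * d ^ t ∣ p * k := by
  have not_dvd {c : ℤ} (hc : 1 < c) (h : IsCoprime (M : ℤ) c) : ¬ c ∣ M := fun h' => by
    have := Int.isUnit_iff.1 (h.isUnit_of_dvd' h' dvd_rfl)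
    lia
  have hper : 1 < per a b e ∧ IsCoprime (per a b e) M ∧ ¬ per a b (-e) ∣ M := by
    rcases Int.units_eq_one_or e with rfl | rfl
    exacts [⟨ha, hMa.symm, not_dvd hb hMb⟩, ⟨hb, hMb.symm, not_dvd ha hMa⟩]
  set g : K := ⟨conjY a b M e i,
    K.normalCore_le (conjY_mem (by rwa [zpow_natCast]) e i)⟩ with hg
  have hgv (n : ℤ) : Commute g (v ^ n) ↔ per a b e ^ i ∣ n := by
    rw [← commute_coe_iff, Subgroup.coe_zpow, hv, ← zpow_natCast, ← zpow_mul,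
      commute_conjY_iff hab (by lia) (by lia) hper.2.2]
    exact ⟨hper.2.1.pow_left.dvd_of_dvd_mul_left, fun h => h.mul_left _⟩
  have hgw (k : ℤ) : per a b e ^ i ∣ q * k ↔ Commute (φ g : BS c d) (y c d ^ (N * (p * k))) := by
    have : (y c d ^ (N * (p * k)) : BS c d) = φ (v ^ (q * k)) := by
      rw [zpow_mul v, map_zpow, h, ← zpow_mul, Subgroup.coe_zpow, hw, ← zpow_natCast, ← zpow_mul]
    rw [this, commute_coe_iff, commute_map_iff φ.injective, hgv]
  obtain ⟨s, t, hst⟩ := exists_commute_iff hcd (by lia) (by lia) (k := N * (p * per a b e ^ i))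
    (mul_ne_zero (by lia) (mul_ne_zero hp (pow_ne_zero _ (by lia))))
    ((hgw _).1 (dvd_mul_left _ _))
  refine ⟨s, t, fun k => ?_⟩
  rw [hgw, hst]
  exact ⟨(hNc.symm.pow_left.mul_left hNd.symm.pow_left).dvd_of_dvd_mul_left,
    fun h => h.mul_left _⟩

section Factorization

lemma factorization_sub_le {m n p q : ℕ} (hm : m ≠ 0) (hn : n ≠ 0) (hp : p ≠ 0)
    (hq : q ≠ 0) (h : ∀ k, n ∣ q * k → m ∣ p * k) (r : ℕ) :
    m.factorization r - p.factorization r ≤ n.factorization r - q.factorization r := by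
  have hg := n.gcd_dvd_left q
  have h₁ := h (n / n.gcd q) (by
    rw [← Nat.mul_div_assoc _ hg, mul_comm, Nat.mul_div_assoc _ (n.gcd_dvd_right q)]
    exact dvd_mul_right _ _)
  have hk : n / n.gcd q ≠ 0 := (Nat.div_pos (Nat.le_of_dvd (Nat.pos_of_ne_zero hn) hg)
    (Nat.gcd_pos_of_pos_left _ (Nat.pos_of_ne_zero hn))).ne'
  have h₂ := (Nat.factorization_le_iff_dvd hm (mul_ne_zero hp hk)).2 h₁ r
  rw [Nat.factorization_mul hp hk, Nat.factorization_div hg, Nat.factorization_gcd hn hq] at h₂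
  simp only [Finsupp.coe_add, Pi.add_apply, Finsupp.coe_tsub, Pi.sub_apply,
    Finsupp.inf_apply] at h₂
  omega

/-- Up to fixed truncations, powers of `a` have the same factorizations as some products of powers
of `c` and `d`. -/
def PowersMatch (a c d : ℕ) (q p : ℕ → ℕ) : Prop :=
  ∀ i, ∃ s t, ∀ r, i * a.factorization r - q r =
    s * c.factorization r + t * d.factorization r - p r

variable {a b c d : ℕ} {p q : ℕ → ℕ}

lemma PowersMatch.symm (h : PowersMatch a c d q p) : PowersMatch a d c q p := fun i => by
  obtain ⟨s, t, hst⟩ := h i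
  exact ⟨t, s, fun r => by rw [hst, add_comm]⟩

lemma powersMatch_of_dvd_iff {p q : ℕ} (ha : a ≠ 0) (hc : c ≠ 0) (hd : d ≠ 0) (hp : p ≠ 0)
    (hq : q ≠ 0) (h : ∀ i, ∃ s t, ∀ k, a ^ i ∣ q * k ↔ c ^ s * d ^ t ∣ p * k) :
    PowersMatch a c d q.factorization p.factorization := fun i => by
  obtain ⟨s, t, hst⟩ := h i
  refine ⟨s, t, fun r => ?_⟩
  have hcd : c ^ s * d ^ t ≠ 0 := mul_ne_zero (pow_ne_zero _ hc) (pow_ne_zero _ hd)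
  have h₁ := factorization_sub_le hcd (pow_ne_zero i ha) hp hq (fun k => (hst k).1) r
  have h₂ := factorization_sub_le (pow_ne_zero i ha) hcd hq hp (fun k => (hst k).2) r
  have := le_antisymm h₂ h₁
  rwa [Nat.factorization_mul (pow_ne_zero _ hc) (pow_ne_zero _ hd), Nat.factorization_pow,
    Nat.factorization_pow, Nat.factorization_pow] at this

lemma factorization_eq_zero_or (hcd : c.Coprime d) (r : ℕ) :
    c.factorization r = 0 ∨ d.factorization r = 0 := by
  by_contra! h
  have hr := Nat.eq_one_of_dvd_coprimes hcd (Nat.dvd_of_factorization_pos h.1)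
    (Nat.dvd_of_factorization_pos h.2)
  exact h.1 (by rw [hr, Nat.factorization_one_right])

lemma PowersMatch.factorization_pos (h : PowersMatch a c d q p) {r : ℕ}
    (ha : 0 < a.factorization r) : 0 < c.factorization r ∨ 0 < d.factorization r := by
  by_contra! h'
  obtain ⟨s, t, hst⟩ := h (q r + 1)
  have := hst r
  simp only [Nat.le_zero.1 h'.1, Nat.le_zero.1 h'.2, mul_zero, add_zero, Nat.zero_sub] at this
  have := Nat.le_mul_of_pos_right (q r + 1) ha
  omega

lemma PowersMatch.support_subset (h : PowersMatch a c d q p) (hcd : c.Coprime d) {r u : ℕ}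
    (ha : 0 < a.factorization r) (hc : 0 < c.factorization r) (hu : 0 < c.factorization u) :
    0 < a.factorization u := by
  by_contra! h'
  obtain ⟨s, t, hst⟩ := h (q r + p u * c.factorization r + 1)
  have h₁ := hst r
  have h₂ := hst u
  rw [Nat.le_zero.1 h', (factorization_eq_zero_or hcd u).resolve_left hu.ne'] at h₂
  rw [(factorization_eq_zero_or hcd r).resolve_left hc.ne'] at h₁
  have h₃ := Nat.le_mul_of_pos_right (q r + p u * c.factorization r + 1) ha
  have h₄ := Nat.le_mul_of_pos_right s hu
  have h₅ : s * c.factorization r ≤ p u * c.factorization r :=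
    Nat.mul_le_mul_right _ (by omega)
  omega

lemma PowersMatch.factorization_dvd (h : PowersMatch a c d q p) (hcd : c.Coprime d) {r : ℕ}
    (ha : 0 < a.factorization r) (hc : 0 < c.factorization r) :
    c.factorization r ∣ a.factorization r := by
  obtain ⟨s, t, hst⟩ := h (q r + 1)
  obtain ⟨s', t', hst'⟩ := h (q r + 1 + 1)
  have h₁ := hst r
  have h₂ := hst' r
  rw [(factorization_eq_zero_or hcd r).resolve_left hc.ne'] at h₁ h₂
  rw [add_one_mul (q r + 1)] at h₂
  have h₃ := Nat.le_mul_of_pos_right (q r + 1) ha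
  have : a.factorization r = s' * c.factorization r - s * c.factorization r := by omega
  rw [this, ← Nat.sub_mul]
  exact dvd_mul_left _ _

lemma eq_of_powersMatch (h : PowersMatch a c d q p) (h' : PowersMatch c a b p q)
    (hab : a.Coprime b) (hcd : c.Coprime d) (ha₀ : a ≠ 0) (hc₀ : c ≠ 0) {r : ℕ}
    (ha : 0 < a.factorization r) (hc : 0 < c.factorization r) : a = c := by
  refine Nat.eq_of_factorization_eq ha₀ hc₀ fun u => ?_
  rcases Nat.eq_zero_or_pos (a.factorization u) with hu | hu
  · by_contra hne
    exact (h.support_subset hcd ha hc (Nat.pos_of_ne_zero fun h => hne (hu.trans h.symm))).ne' hu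
  · have hu' := h'.support_subset hab hc ha hu
    exact Nat.dvd_antisymm (h'.factorization_dvd hab hu' hu) (h.factorization_dvd hcd hu hu')

lemma eq_or_eq_of_powersMatch (h : PowersMatch a c d q p) (hc : PowersMatch c a b p q)
    (hd : PowersMatch d a b p q) (hab : a.Coprime b) (hcd : c.Coprime d) (ha₁ : 1 < a)
    (hc₀ : c ≠ 0) (hd₀ : d ≠ 0) : a = c ∨ a = d := by
  obtain ⟨r, hr, hra⟩ := Nat.exists_prime_and_dvd ha₁.ne'
  have ha := hr.factorization_pos_of_dvd (by omega) hra
  exact (h.factorization_pos ha).imp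
    (eq_of_powersMatch h hc hab hcd (by omega) hc₀ ha)
    (eq_of_powersMatch h.symm hd hab hcd.symm (by omega) hd₀ ha)

end Factorization

lemma exists_map_zpow_eq (hab : IsCoprime a b) (ha : 1 < a) (hb : 1 < b)
    (hcd : IsCoprime c d) (hc : 1 < c) (hd : 1 < d)
    {K : Subgroup (BS a b)} {L : Subgroup (BS c d)} (hL : L.index ≠ 0) (φ : K ≃* L) {M N : ℕ}
    (hM₀ : 0 < M) (hN₀ : 0 < N) {v : K} {w : L}
    (hv : (v : BS a b) = y a b ^ M) (hw : (w : BS c d) = y c d ^ N) :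
    ∃ p q : ℤ, p ≠ 0 ∧ q ≠ 0 ∧ φ (v ^ q) = w ^ p := by
  obtain ⟨k, m, hk, hkm⟩ := exists_pow_eq_y_zpow hcd hc hd hL (v := φ v) fun g hg => by
    obtain ⟨k, m, hk, hm, h⟩ :=
      exists_pos_y_zpow_mul hab (by lia) (by lia) (φ.symm ⟨g, hg⟩ : BS a b)
    refine ⟨m, k, hm, hk, ?_⟩
    have h' : φ.symm ⟨g, hg⟩ * v ^ m = v ^ k * φ.symm ⟨g, hg⟩ := by
      have h₁ : SemiconjBy (φ.symm ⟨g, hg⟩ : BS a b) (y a b ^ m) (y a b ^ k) := h.symm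
      have h₂ := h₁.pow_right M
      rw [← pow_mul, ← pow_mul, mul_comm m, mul_comm k, pow_mul, pow_mul, ← hv] at h₂
      exact Subtype.ext h₂.eq
    have := congrArg (fun z => (φ z : BS c d)) h'
    simpa using this
  have hinj : φ (v ^ (k * N : ℤ)) = w ^ m := by
    refine Subtype.ext ?_
    rw [map_zpow, Subgroup.coe_zpow, Subgroup.coe_zpow, hw, zpow_mul, zpow_natCast,
      zpow_natCast, hkm, ← zpow_natCast, ← zpow_natCast, ← zpow_mul, ← zpow_mul, mul_comm]
  refine ⟨m, k * N, ?_, by positivity, hinj⟩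
  rintro rfl
  rw [zpow_zero, map_eq_one_iff _ φ.injective] at hinj
  have h₁ := congrArg (fun z : K => (z : BS a b)) hinj
  simp only [Subgroup.coe_zpow, Subgroup.coe_one, hv] at h₁
  rw [← zpow_natCast, ← zpow_mul] at h₁
  have h₂ := y_zpow_injective (by lia) (by lia) h₁
  have : (M : ℤ) * (k * N) ≠ 0 := by positivity
  exact this h₂

lemma powersMatch_of_int {a c d : ℕ} {p q : ℤ} (ha : 1 < a) (hc : 1 < c) (hd : 1 < d)
    (hp : p ≠ 0) (hq : q ≠ 0)
    (h : ∀ i : ℕ, ∃ s t : ℕ, ∀ k : ℤ, (a : ℤ) ^ i ∣ q * k ↔ (c : ℤ) ^ s * (d : ℤ) ^ t ∣ p * k) :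
    PowersMatch a c d q.natAbs.factorization p.natAbs.factorization := by
  refine powersMatch_of_dvd_iff (by lia) (by lia) (by lia) (by lia) (by lia) fun i => ?_
  obtain ⟨s, t, hst⟩ := h i
  refine ⟨s, t, fun k => ?_⟩
  have := hst k
  rwa [← Nat.cast_pow, ← Nat.cast_pow, ← Nat.cast_pow, ← Nat.cast_mul, Int.natCast_dvd,
    Int.natCast_dvd, Int.natAbs_mul, Int.natAbs_mul, Int.natAbs_natCast] at this

end BaumslagSolitar

open BaumslagSolitar

/-- If `1 < a < b`, `1 < c < d`, `gcd(a,b) = gcd(c,d) = 1` and `(a,b) ≠ (c,d)`, then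
`BS(a,b)` and `BS(c,d)` are not abstractly commensurable. -/
theorem BS_not_commensurable (a b c d : ℤ) (ha : 1 < a) (hab : a < b)
    (hc : 1 < c) (hcd : c < d) (hcop₁ : Int.gcd a b = 1) (hcop₂ : Int.gcd c d = 1)
    (hne : (a, b) ≠ (c, d)) :
    ¬ AbstractlyCommensurable (BS a b) (BS c d) := by
  rintro ⟨K, L, hK, hL, ⟨φ⟩⟩
  have hb : 1 < b := ha.trans hab
  have hd : 1 < d := hc.trans hcd
  have hab' := Int.isCoprime_iff_gcd_eq_one.2 hcop₁
  have hcd' := Int.isCoprime_iff_gcd_eq_one.2 hcop₂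
  obtain ⟨M, hM₀, hMa, hMb, hM⟩ := exists_y_pow_mem_normalCore hab' (by lia) (by lia) K hK
  obtain ⟨N, hN₀, hNc, hNd, hN⟩ := exists_y_pow_mem_normalCore hcd' (by lia) (by lia) L hL
  obtain ⟨v, hv⟩ : ∃ v : K, (v : BS a b) = y a b ^ M := ⟨⟨_, K.normalCore_le hM⟩, rfl⟩
  obtain ⟨w, hw⟩ : ∃ w : L, (w : BS c d) = y c d ^ N := ⟨⟨_, L.normalCore_le hN⟩, rfl⟩
  obtain ⟨p, q, hp, hq, hφ⟩ := exists_map_zpow_eq hab' ha hb hcd' hc hd hL φ hM₀ hN₀ hv hw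
  have h₁ := exists_dvd_iff_dvd hab' ha hb hcd' hc hd φ hN₀ hMa hMb hM hNc hNd hv hw hp hφ
  have h₂ := exists_dvd_iff_dvd hcd' hc hd hab' ha hb φ.symm hM₀ hNc hNd hN hMa hMb hw hv hq
    (by rw [← hφ, φ.symm_apply_apply])
  clear hφ
  clear hw w hv v
  clear hM hN φ hK hL K L
  lift a to ℕ using by lia
  lift b to ℕ using by lia
  lift c to ℕ using by lia
  lift d to ℕ using by lia
  norm_cast at ha hb hc hd hab hcd
  rw [Int.gcd_natCast_natCast] at hcop₁ hcop₂
  have ha' := powersMatch_of_int ha hc hd hp hq (h₁ 1)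
  have hb' := powersMatch_of_int hb hc hd hp hq (by simpa [per] using h₁ (-1))
  have hc' := powersMatch_of_int hc ha hb hq hp (h₂ 1)
  have hd' := powersMatch_of_int hd ha hb hq hp (by simpa [per] using h₂ (-1))
  have h₃ := eq_or_eq_of_powersMatch ha' hc' hd' hcop₁ hcop₂ ha (by lia) (by lia)
  have h₄ := eq_or_eq_of_powersMatch hb' hc'.symm hd'.symm (Nat.Coprime.symm hcop₁) hcop₂ hb
    (by lia) (by lia)
  rcases h₃ with rfl | rfl <;> rcases h₄ with rfl | rfl <;> lia
end

section
/- Let T be a locally finite tree with a height function h : V(T) → ℝ. The following are equivalent: (a) for every pair of vertices v, w there is a graph automorphism φ of T with φ(v) = w which preserves height changes, i.e. h(φ(u)) − h(φ(u')) = h(u) − h(u') for all vertices u, u'; (b) for every pair of vertices v, w, the multiset of height changes h(u) − h(v) over neighbors u of v equals the multiset of height changes h(u) − h(w) over neighbors u of w. -/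
/-- If the images of two finsets under `f` and `g` agree as multisets, then there is a bijection
between the finsets intertwining `f` and `g`. -/
theorem Finset.exists_bijOn_of_map_val_eq {α β γ : Type*} [Nonempty β] (f : α → γ) (g : β → γ)
    (s : Finset α) (t : Finset β) (hst : s.val.map f = t.val.map g) :
    ∃ e : α → β, Set.BijOn e s t ∧ ∀ a ∈ s, g (e a) = f a := by
  classical
  induction s using Finset.induction_on generalizing t with
  | empty =>
    have ht : t = ∅ := by simpa using hst.symm
    subst ht
    exact ⟨fun _ => Classical.arbitrary β, by simp, by simp⟩
  | insert a s ha ih =>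
    rw [Finset.insert_val_of_notMem ha, Multiset.map_cons] at hst
    obtain ⟨b, hb, hba⟩ : ∃ b ∈ t, g b = f a := by
      have := hst ▸ Multiset.mem_cons_self (f a) (s.val.map f)
      simpa using this
    rw [← Finset.insert_erase hb, Finset.insert_val_of_notMem (Finset.notMem_erase b t),
      Multiset.map_cons, hba, Multiset.cons_inj_right] at hst
    obtain ⟨e, he, hfe⟩ := ih _ hst
    have hne : ∀ x ∈ s, x ≠ a := fun x hx hxa => ha (hxa ▸ hx)
    have he' : Set.BijOn (Function.update e a b) s (t.erase b) :=
      he.congr fun x hx => (Function.update_of_ne (hne x hx) _ _).symm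
    refine ⟨Function.update e a b, ?_, ?_⟩
    · have := he'.insert (a := a) (by simp)
      rw [Function.update_self, ← Finset.coe_insert, ← Finset.coe_insert,
        Finset.insert_erase hb] at this
      exact this
    · intro x hx
      rcases Finset.mem_insert.mp hx with rfl | hx
      · simpa using hba
      · rw [Function.update_of_ne (hne x hx)]
        exact hfe x hx

namespace SimpleGraph

variable {V W : Type*} {G : SimpleGraph V} {H : SimpleGraph W}

/-- A locally injective homomorphism into an acyclic graph maps paths to paths. -/
theorem Walk.IsPath.map_of_injOn_neighborSet (hH : H.IsAcyclic) (φ : G →g H)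
    (hφ : ∀ x, Set.InjOn φ (G.neighborSet x)) {x y : V} {p : G.Walk x y} (hp : p.IsPath) :
    (p.map φ).IsPath := by
  induction p with
  | nil => simp
  | @cons u v w huv p ih =>
    obtain ⟨hp, hu⟩ := (Walk.cons_isPath_iff _ _).mp hp
    rw [Walk.map_cons, Walk.cons_isPath_iff]
    refine ⟨ih hp, fun hmem => hu ?_⟩
    have hsnd := hH.eq_snd_of_adj_start (ih hp) (φ.map_adj huv.symm) hmem
    rw [Walk.snd, Walk.getVert_map] at hsnd
    have hnil : ¬ p.Nil := by
      intro hnil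
      have hv : p.getVert 1 = v := by
        cases p with
        | nil => rfl
        | cons _ _ => simp at hnil
      exact (φ.map_adj huv).ne (hv ▸ hsnd)
    have : u = p.snd := hφ v huv.symm (p.adj_snd hnil) hsnd
    exact this ▸ p.getVert_mem_support 1

/-- A homomorphism of trees that is bijective on the neighbors of every vertex is an isomorphism. -/
theorem IsTree.exists_iso_of_bijOn_neighborSet (hG : G.IsTree) (hH : H.IsTree) (φ : V → W)
    (hφ : ∀ x, Set.BijOn φ (G.neighborSet x) (H.neighborSet (φ x))) :
    ∃ ψ : G ≃g H, ⇑ψ = φ := by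
  let F : G →g H := ⟨φ, fun {a b} hab => (hφ a).mapsTo hab⟩
  have hinj : Function.Injective φ := by
    intro x y hxy
    obtain ⟨p, hp, -⟩ := hG.existsUnique_path x y
    have hq : (p.map F).IsPath :=
      hp.map_of_injOn_neighborSet hH.isAcyclic F fun x => (hφ x).injOn
    have hend : (p.map F).getVert (p.map F).length = (p.map F).getVert 0 := by
      rw [Walk.getVert_length, Walk.getVert_zero]
      exact hxy.symm
    have hlen : (p.map F).length = 0 :=
      hq.getVert_injOn (by simp) (by simp) hend
    rw [Walk.length_map] at hlen
    exact Walk.eq_of_length_eq_zero hlen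
  have hsurj : Function.Surjective φ := by
    obtain ⟨x⟩ := hG.connected.nonempty
    intro y
    obtain ⟨p⟩ := hH.connected.preconnected y (φ x)
    generalize hz : φ x = z at p
    induction p with
    | nil => exact ⟨x, hz⟩
    | cons hadj _ ih =>
      obtain ⟨a, rfl⟩ := ih hz
      obtain ⟨b, -, hb⟩ := (hφ a).surjOn hadj.symm
      exact ⟨b, hb⟩
  refine ⟨⟨Equiv.ofBijective φ ⟨hinj, hsurj⟩, ?_⟩, rfl⟩
  intro a b
  refine ⟨fun hab => ?_, fun hab => (hφ a).mapsTo hab⟩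
  obtain ⟨c, hc, hcb⟩ := (hφ a).surjOn hab
  exact hinj hcb ▸ hc

/-- A rooted tree carries a depth function and a parent function: every vertex other than the root
is adjacent to its parent and one deeper, and of two adjacent vertices one is the parent of the
other. -/
theorem IsTree.exists_depth_parent (hG : G.IsTree) (r : V) :
    ∃ (d : V → ℕ) (par : V → V), d r = 0 ∧
      (∀ x, x ≠ r → G.Adj (par x) x ∧ d x = d (par x) + 1) ∧
      ∀ a b, G.Adj a b → (b ≠ r ∧ par b = a) ∨ (a ≠ r ∧ par a = b) := by
  choose P hP _ using fun x => hG.existsUnique_path r x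
  have hroot : P r = .nil := Walk.eq_nil_iff_nil.mpr (Walk.isPath_iff_nil.mp (hP r))
  have hparent : ∀ a b (hab : G.Adj a b), P b = (P a).concat hab →
      b ≠ r ∧ (P b).penultimate = a := by
    intro a b hab hPb
    refine ⟨?_, by rw [hPb, Walk.penultimate_concat]⟩
    rintro rfl
    have := congrArg Walk.length hPb
    simp [hroot] at this
  refine ⟨fun x => (P x).length, fun x => (P x).penultimate, ?_, fun x hx => ?_, fun a b hab => ?_⟩
  · simp [hroot]
  · have hadj : G.Adj (P x).penultimate x := (P x).adj_penultimate (Walk.not_nil_of_ne hx.symm)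
    have hPx := hG.isAcyclic.path_concat (hP _) (hP x) hadj ((P x).getVert_mem_support _)
    refine ⟨hadj, ?_⟩
    have := congrArg Walk.length hPx
    rwa [Walk.length_concat] at this
  · by_cases hmem : a ∈ (P b).support
    · exact .inl (hparent a b hab (hG.isAcyclic.path_concat (hP a) (hP b) hab hmem))
    · have hmem' := hG.isAcyclic.mem_support_of_ne_mem_support_of_adj_of_isPath (hP a) (hP b)
        hab hmem
      exact .inr (hparent b a hab.symm
        (hG.isAcyclic.path_concat (hP b) (hP a) hab.symm hmem'))

/-- Functions on a rooted tree can be defined by recursion from each vertex to its parent. -/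
theorem IsTree.exists_parent_recursion (hG : G.IsTree) (r : V) :
    ∃ par : V → V, (∀ x, x ≠ r → G.Adj (par x) x) ∧
      (∀ a b, G.Adj a b → (b ≠ r ∧ par b = a) ∨ (a ≠ r ∧ par a = b)) ∧
      (∀ motive : V → Prop, motive r → (∀ x, x ≠ r → motive (par x) → motive x) →
        ∀ x, motive x) ∧
      ∀ {A : Type*} (a₀ : A) (step : V → A → A),
        ∃ F : V → A, F r = a₀ ∧ ∀ x, x ≠ r → F x = step x (F (par x)) := by
  obtain ⟨d, par, hdr, hd, hpar⟩ := hG.exists_depth_parent r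
  refine ⟨par, fun x hx => (hd x hx).1, hpar, ?_, ?_⟩
  · intro motive hr hstep x
    induction hn : d x using Nat.strong_induction_on generalizing x with
    | _ n ih =>
      by_cases hx : x = r
      · exact hx ▸ hr
      · exact hstep x hx (ih _ (by have := (hd x hx).2; omega) _ rfl)
  · intro A a₀ step
    let S : ℕ → V → A := fun n => n.rec (fun _ => a₀) fun _ T x => step x (T (par x))
    exact ⟨fun x => S (d x) x, by simp [hdr, S], fun x hx => by simp [(hd x hx).2, S]⟩

/-- In a homogeneous tree, any vertex can be moved to any other by a map that is bijective on
neighbors and preserves height changes along edges. -/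
theorem IsTree.exists_bijOn_neighborSet (hG : G.IsTree) (h : V → ℝ)
    (hloc : ∀ x y, ∃ f : V → V, Set.BijOn f (G.neighborSet x) (G.neighborSet y) ∧
      ∀ u ∈ G.neighborSet x, h (f u) - h y = h u - h x) (v w : V) :
    ∃ φ : V → V, φ v = w ∧ ∀ x, Set.BijOn φ (G.neighborSet x) (G.neighborSet (φ x)) ∧
      ∀ u ∈ G.neighborSet x, h (φ u) - h (φ x) = h u - h x := by
  classical
  have hext : ∀ x y p q, G.Adj x p → G.Adj y q → h q - h y = h p - h x →
      ∃ f : V → V, (Set.BijOn f (G.neighborSet x) (G.neighborSet y) ∧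
        ∀ u ∈ G.neighborSet x, h (f u) - h y = h u - h x) ∧ f p = q := by
    intro x y p q hp hq hpq
    obtain ⟨f, hf, hfh⟩ := hloc x y
    have hfp : G.Adj y (f p) := hf.mapsTo hp
    have hheq : h (f p) = h q := by linarith [hfh p hp]
    have hswap : Set.BijOn (Equiv.swap (f p) q) (G.neighborSet y) (G.neighborSet y) :=
      Equiv.swap_bijOn_self (iff_of_true hfp hq)
    refine ⟨Equiv.swap (f p) q ∘ f, ⟨hswap.comp hf, fun u hu => ?_⟩, by simp⟩
    rw [← hfh u hu, Function.comp_apply, Equiv.swap_apply_def]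
    split_ifs <;> simp_all
  choose! E hE hEp using hext
  choose f₀ hf₀ using hloc v w
  obtain ⟨par, hadj, hpar, hind, hrec⟩ := hG.exists_parent_recursion v
  obtain ⟨F, hFv, hF⟩ := hrec (w, f₀) fun x T => (T.2 x, E x (T.2 x) (par x) T.1)
  have hFgood : ∀ x, Set.BijOn (F x).2 (G.neighborSet x) (G.neighborSet (F x).1) ∧
      ∀ u ∈ G.neighborSet x, h ((F x).2 u) - h (F x).1 = h u - h x := by
    refine hind _ (by rwa [hFv]) fun x hx ih => ?_
    rw [hF x hx]
    exact hE _ _ _ _ (hadj x hx).symm (ih.1.mapsTo (hadj x hx)).symm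
      (by linarith [ih.2 x (hadj x hx)])
  have hFadj : ∀ x, ∀ u ∈ G.neighborSet x, (F x).2 u = (F u).1 := by
    intro x u hxu
    rcases hpar x u hxu with ⟨hu, rfl⟩ | ⟨hx, rfl⟩
    · rw [hF u hu]
    · have ih := hFgood (par x)
      rw [hF x hx]
      exact hEp _ _ _ _ hxu (ih.1.mapsTo hxu.symm).symm (by linarith [ih.2 x hxu.symm])
  refine ⟨fun x => (F x).1, by simp [hFv], fun x => ⟨(hFgood x).1.congr (hFadj x), fun u hu => ?_⟩⟩
  rw [← (hFgood x).2 u hu, hFadj x u hu]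

end SimpleGraph

/-- For a locally finite tree with a height function, transitivity of the
height-change preserving automorphism group is equivalent to all vertices having the
same multiset of height changes along incident edges (homogeneity). -/
theorem heightChange_transitive_iff_homogeneous {V : Type*} (G : SimpleGraph V)
    (h : V → ℝ) (hT : G.IsTree) (hlf : ∀ v : V, (G.neighborSet v).Finite) :
    (∀ v w : V, ∃ φ : G ≃g G, φ v = w ∧
      ∀ u u' : V, h (φ u) - h (φ u') = h u - h u') ↔
    (∀ v w : V,
      Multiset.map (fun u => h u - h v) (hlf v).toFinset.val =
      Multiset.map (fun u => h u - h w) (hlf w).toFinset.val) := by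
  constructor
  · intro H v w
    obtain ⟨φ, rfl, hφ⟩ := H v w
    have hN : (hlf (φ v)).toFinset = (hlf v).toFinset.map φ.toEquiv.toEmbedding := by
      ext u
      simp only [Set.Finite.mem_toFinset, SimpleGraph.mem_neighborSet, Finset.mem_map_equiv]
      change G.Adj (φ v) u ↔ G.Adj v (φ.symm u)
      rw [← φ.map_adj_iff (v := v), φ.apply_symm_apply]
    rw [hN, Finset.map_val, Multiset.map_map]
    exact Multiset.map_congr rfl fun u _ => (hφ u v).symm
  · intro H v w
    have hloc : ∀ x y, ∃ f : V → V, Set.BijOn f (G.neighborSet x) (G.neighborSet y) ∧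
        ∀ u ∈ G.neighborSet x, h (f u) - h y = h u - h x := by
      intro x y
      have : Nonempty V := ⟨x⟩
      simpa using Finset.exists_bijOn_of_map_val_eq _ _ _ _ (H x y)
    obtain ⟨φ, hvw, hφ⟩ := hT.exists_bijOn_neighborSet h hloc v w
    obtain ⟨ψ, rfl⟩ := hT.exists_iso_of_bijOn_neighborSet hT φ fun x => (hφ x).1
    refine ⟨ψ, hvw, fun u u' => ?_⟩
    obtain ⟨p⟩ := hT.connected.preconnected u u'
    induction p with
    | nil => simp
    | cons hadj _ ih => linarith [(hφ _).2 _ hadj]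
end
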